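/- arXiv:2303.04041 — 6 statements merged into one kernel-verified Lean document; each statement's English description precedes it below -/
import Mathlib

section
/- Let q ≥ 2 be an integer and let U be a q-step kernel with parts A₁,…,A_q such that the degrees of vertices in different parts are different, i.e., writing d_i for the common value of deg_U(x) = ∫₀¹ U(x,y) dy for x∈A_i, the reals d₁,…,d_q are pairwise distinct. If U' is a kernel such that t(H,U') = t(H,U) for every finite simple graph H with at most 2q+1 vertices, then U and U' are weakly isomorphic. -/
open MeasureTheory
open scoped BigOperators Classical

noncomputable section

abbrev I01 : Type := Set.Icc (0 : ℝ) 1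

/-- A kernel: a bounded measurable symmetric function on `[0,1]²`. -/
structure GKernel where
  toFun : I01 → I01 → ℝ
  measurable' : Measurable (Function.uncurry toFun)
  bounded' : ∃ C : ℝ, ∀ x y, |toFun x y| ≤ C
  symm' : ∀ x y, toFun x y = toFun y x

/-- A graphon is a kernel with values in `[0,1]`. -/
def GKernel.IsGraphon (U : GKernel) : Prop :=
  ∀ x y, U.toFun x y ∈ Set.Icc (0 : ℝ) 1

/-- Homomorphism density of a finite simple graph in a kernel. -/
def homDensity {n : ℕ} (H : SimpleGraph (Fin n)) (U : GKernel) : ℝ :=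
  ∫ x : Fin n → I01,
    ∏ e ∈ (Set.toFinite H.edgeSet).toFinset,
      Sym2.lift ⟨fun u v => U.toFun (x u) (x v), fun _ _ => U.symm' _ _⟩ e

/-- Two kernels are weakly isomorphic if all homomorphism densities coincide. -/
def WeaklyIsomorphic (U U' : GKernel) : Prop :=
  ∀ (n : ℕ) (H : SimpleGraph (Fin n)), homDensity H U = homDensity H U'

/-- `A` is a partition of `[0,1]` into `q` measurable parts of positive measure
on whose pairwise products `U` is constant. -/
def IsStepPartition (U : GKernel) {q : ℕ} (A : Fin q → Set I01) : Prop :=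
  (∀ i, MeasurableSet (A i)) ∧
  (∀ i, 0 < volume (A i)) ∧
  Pairwise (fun i j => Disjoint (A i) (A j)) ∧
  (⋃ i, A i) = Set.univ ∧
  (∀ i j, ∃ c : ℝ, ∀ x ∈ A i, ∀ y ∈ A j, U.toFun x y = c)

def HasStepPartition (U : GKernel) (q : ℕ) : Prop :=
  ∃ A : Fin q → Set I01, IsStepPartition U A

/-- A `q`-step kernel: a step partition into `q` parts exists but none into `q - 1` parts. -/
def IsStepKernel (U : GKernel) (q : ℕ) : Prop :=
  HasStepPartition U q ∧ ¬ HasStepPartition U (q - 1)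

/-- The degree of a vertex `x` in a kernel. -/
def GKernel.degree (U : GKernel) (x : I01) : ℝ := ∫ y : I01, U.toFun x y

/-- Density of a rooted graph (roots `R`, non-root vertices `Fin b`) in a kernel,
for a given choice `x` of the roots. -/
def rootedDensity {R : Type} [Fintype R] {b : ℕ}
    (H : SimpleGraph (R ⊕ Fin b)) (U : GKernel) (x : R → I01) : ℝ :=
  ∫ y : Fin b → I01,
    ∏ e ∈ (Set.toFinite H.edgeSet).toFinset,
      Sym2.lift ⟨fun u v => U.toFun (Sum.elim x y u) (Sum.elim x y v),
        fun _ _ => U.symm' _ _⟩ e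

/-- `U` takes the constant value `v` on `A i × A j`. -/
def PartDensityIs (U : GKernel) {q : ℕ} (A : Fin q → Set I01) (i j : Fin q) (v : ℝ) : Prop :=
  ∀ x ∈ A i, ∀ y ∈ A j, U.toFun x y = v

/-- A set of pairwise vertex-disjoint edges. -/
def IsMatchingSet {V : Type} (S : Set (Sym2 V)) : Prop :=
  (∀ e ∈ S, ¬ e.IsDiag) ∧
  ∀ e ∈ S, ∀ f ∈ S, e ≠ f → ∀ v : V, ¬ (v ∈ e ∧ v ∈ f)

/-- The edges of `S` with both endpoints in `V_i ∪ V_j`, where `V_l` is the set of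
vertices with first coordinate `l`. -/
def EdgesIn {q : ℕ} {s : Fin q → ℕ} (S : Set (Sym2 ((l : Fin q) × Fin (s l))))
    (i j : Fin q) : Set (Sym2 ((l : Fin q) × Fin (s l))) :=
  {e ∈ S | ∀ v ∈ e, v.1 = i ∨ v.1 = j}

def BM {α : Type*} [MeasurableSpace α] (f : α → ℝ) : Prop :=
  Measurable f ∧ ∃ C : ℝ, ∀ x, |f x| ≤ C

namespace BM

variable {α β : Type*} [MeasurableSpace α] [MeasurableSpace β]

lemma const (c : ℝ) : BM (fun _ : α => c) := ⟨measurable_const, |c|, fun _ => le_rfl⟩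

lemma mul {f g : α → ℝ} (hf : BM f) (hg : BM g) : BM (fun x => f x * g x) := by
  obtain ⟨hf, C, hC⟩ := hf
  obtain ⟨hg, D, hD⟩ := hg
  refine ⟨hf.mul hg, C * D, fun x => ?_⟩
  rw [abs_mul]
  exact mul_le_mul (hC x) (hD x) (abs_nonneg _) ((abs_nonneg _).trans (hC x))

lemma add {f g : α → ℝ} (hf : BM f) (hg : BM g) : BM (fun x => f x + g x) := by
  obtain ⟨hf, C, hC⟩ := hf
  obtain ⟨hg, D, hD⟩ := hg
  exact ⟨hf.add hg, C + D, fun x => (abs_add_le _ _).trans (add_le_add (hC x) (hD x))⟩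

lemma sub {f g : α → ℝ} (hf : BM f) (hg : BM g) : BM (fun x => f x - g x) := by
  have := hf.add ((BM.const (-1)).mul hg)
  convert this using 2
  ring

lemma pow {f : α → ℝ} (hf : BM f) (n : ℕ) : BM (fun x => f x ^ n) := by
  induction n with
  | zero => simpa using BM.const (α := α) 1
  | succ n ih => simpa [pow_succ] using ih.mul hf

lemma sum {ι : Type*} (s : Finset ι) {f : ι → α → ℝ} (hf : ∀ i ∈ s, BM (f i)) :
    BM (fun x => ∑ i ∈ s, f i x) := by
  induction s using Finset.induction_on with
  | empty => simpa using BM.const (α := α) 0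
  | insert a s ha ih =>
    simp only [Finset.sum_insert ha]
    exact (hf a (by simp)).add (ih fun i hi => hf i (by simp [hi]))

lemma prod {ι : Type*} (s : Finset ι) {f : ι → α → ℝ} (hf : ∀ i ∈ s, BM (f i)) :
    BM (fun x => ∏ i ∈ s, f i x) := by
  induction s using Finset.induction_on with
  | empty => simpa using BM.const (α := α) 1
  | insert a s ha ih =>
    simp only [Finset.prod_insert ha]
    exact (hf a (by simp)).mul (ih fun i hi => hf i (by simp [hi]))

lemma comp {f : α → ℝ} (hf : BM f) {g : β → α} (hg : Measurable g) : BM (fun x => f (g x)) :=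
  ⟨hf.1.comp hg, hf.2.imp fun _ hC _ => hC _⟩

lemma integrable {f : α → ℝ} (hf : BM f) (μ : Measure α) [IsFiniteMeasure μ] : Integrable f μ := by
  obtain ⟨hf, C, hC⟩ := hf
  exact Integrable.of_bound hf.aestronglyMeasurable C (ae_of_all _ hC)

lemma integral {f : α × β → ℝ} (hf : BM f) (μ : Measure β) [IsProbabilityMeasure μ] :
    BM (fun x => ∫ y, f (x, y) ∂μ) := by
  obtain ⟨hf, C, hC⟩ := hf
  refine ⟨(hf.stronglyMeasurable.integral_prod_right').measurable, C, fun x => ?_⟩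
  have := norm_integral_le_of_norm_le_const (μ := μ) (f := fun y => f (x, y)) (C := C)
    (ae_of_all _ fun y => hC (x, y))
  simpa using this

lemma polyEval {f : α → ℝ} (hf : BM f) (p : Polynomial ℝ) : BM (fun x => p.eval (f x)) := by
  simp only [Polynomial.eval_eq_sum_range]
  exact BM.sum _ fun i _ => (BM.const _).mul (hf.pow i)

end BM

lemma GKernel.bm (U : GKernel) : BM (Function.uncurry U.toFun) :=
  ⟨U.measurable', U.bounded'.imp fun _ h x => h x.1 x.2⟩

lemma GKernel.bm2 (U : GKernel) {α : Type*} [MeasurableSpace α] {f g : α → I01}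
    (hf : Measurable f) (hg : Measurable g) : BM (fun x => U.toFun (f x) (g x)) :=
  U.bm.comp (hf.prodMk hg)

lemma GKernel.bm_deg (U : GKernel) : BM U.degree := U.bm.integral volume

def eprod {V : Type*} [Finite V] (H : SimpleGraph V) (U : GKernel) (x : V → I01) : ℝ :=
  ∏ e ∈ (Set.toFinite H.edgeSet).toFinset,
      Sym2.lift ⟨fun u v => U.toFun (x u) (x v), fun _ _ => U.symm' _ _⟩ e

lemma homDensity_eq {n : ℕ} (H : SimpleGraph (Fin n)) (U : GKernel) :
    homDensity H U = ∫ x, eprod H U x := rfl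

lemma eprod_bm {V : Type*} [Fintype V] (H : SimpleGraph V) (U : GKernel) : BM (eprod H U) := by
  unfold eprod
  refine BM.prod _ fun e _ => ?_
  induction e using Sym2.ind with
  | _ u v => exact U.bm2 (measurable_pi_apply u) (measurable_pi_apply v)

lemma eprod_map {V W : Type*} [Fintype V] [Fintype W] (e : V ≃ W) (H : SimpleGraph V) (U : GKernel)
    (x : W → I01) : eprod (H.map e.toEmbedding) U x = eprod H U (x ∘ e) := by
  unfold eprod
  symm
  refine Finset.prod_bij (fun a _ => e.toEmbedding.sym2Map a) ?_ ?_ ?_ ?_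
  · intro a ha
    simp only [Set.Finite.mem_toFinset, SimpleGraph.edgeSet_map] at ha ⊢
    exact ⟨a, ha, rfl⟩
  · intro a _ b _ h
    exact e.toEmbedding.sym2Map.injective h
  · intro b hb
    simp only [Set.Finite.mem_toFinset, SimpleGraph.edgeSet_map] at hb ⊢
    obtain ⟨a, ha, rfl⟩ := hb
    exact ⟨a, ha, rfl⟩
  · intro a _
    induction a using Sym2.ind with
    | _ u v => rfl

lemma hd_equiv {V : Type*} [Fintype V] {n : ℕ} (e : V ≃ Fin n) (H : SimpleGraph V) (U : GKernel) :
    homDensity (H.map e.toEmbedding) U = ∫ x : V → I01, eprod H U x := by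
  rw [homDensity_eq]
  have := (volume_measurePreserving_piCongrLeft (fun _ : Fin n => I01) e).integral_comp
    (MeasurableEquiv.measurableEmbedding _) (eprod (H.map e.toEmbedding) U)
  rw [← this]
  congr 1
  ext x
  rw [eprod_map]
  congr 1
  ext v
  simp [MeasurableEquiv.coe_piCongrLeft]

/-- Core graph `G` with pendant vertices `P` attached along `f`. -/
def pend {C P : Type} (G : SimpleGraph C) (f : P → C) : SimpleGraph (C ⊕ P) where
  Adj a b := match a, b with
    | .inl a, .inl b => G.Adj a b
    | .inl a, .inr p => f p = a
    | .inr p, .inl a => f p = a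
    | .inr _, .inr _ => False
  symm := ⟨fun a b h => by
    cases a <;> cases b <;> simp_all [G.adj_comm]⟩
  loopless := ⟨fun a h => by cases a <;> simp_all⟩

lemma eprod_pend {C P : Type} [Fintype C] [Fintype P] (G : SimpleGraph C) (f : P → C) (U : GKernel)
    (x : C → I01) (y : P → I01) :
    eprod (pend G f) U (Sum.elim x y) = eprod G U x * ∏ p, U.toFun (x (f p)) (y p) := by
  unfold eprod
  have hE : (Set.toFinite (pend G f).edgeSet).toFinset =
      ((Set.toFinite G.edgeSet).toFinset.map (Function.Embedding.sym2Map ⟨Sum.inl, Sum.inl_injective⟩))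
      ∪ (Finset.univ.image fun p : P => s((Sum.inl (f p) : C ⊕ P), Sum.inr p)) := by
    ext e
    induction e using Sym2.ind with
    | _ u v =>
    simp only [Set.Finite.mem_toFinset, Finset.mem_union, Finset.mem_map, Finset.mem_image,
      Finset.mem_univ, true_and, SimpleGraph.mem_edgeSet]
    constructor
    · intro h
      rcases u with u | u <;> rcases v with v | v
      · exact Or.inl ⟨s(u, v), h, rfl⟩
      · refine Or.inr ⟨v, ?_⟩
        have : f v = u := h
        rw [this]
      · refine Or.inr ⟨u, ?_⟩
        have : f u = v := h
        rw [this, Sym2.eq_swap]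
      · exact h.elim
    · rintro (⟨e, he, h⟩ | ⟨p, h⟩)
      · rw [← SimpleGraph.mem_edgeSet, ← h]
        induction e using Sym2.ind with
        | _ a b => exact he
      · rw [← SimpleGraph.mem_edgeSet, ← h]
        exact (rfl : f p = f p)
  rw [hE, Finset.prod_union, Finset.prod_map, Finset.prod_image]
  · congr 1
    · refine Finset.prod_congr rfl fun e _ => ?_
      induction e using Sym2.ind with
      | _ a b => rfl
  · intro p _ p' _ h
    simp only [Sym2.eq_iff] at h
    rcases h with h | h
    · simpa using h.2
    · simp at h
  · rw [Finset.disjoint_left]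
    intro e he he'
    simp only [Finset.mem_map, Finset.mem_image, Finset.mem_univ, true_and] at he he'
    obtain ⟨p, rfl⟩ := he'
    obtain ⟨e, _, h⟩ := he
    induction e using Sym2.ind with
    | _ a b =>
      simp [Function.Embedding.sym2Map] at h

lemma integral_pend {C P : Type} [Fintype C] [Fintype P] (G : SimpleGraph C) (f : P → C)
    (U : GKernel) : ∫ z, eprod (pend G f) U z = ∫ x, eprod G U x * ∏ p, U.degree (x (f p)) := by
  have h := (volume_measurePreserving_sumPiEquivProdPi_symm (fun _ : C ⊕ P => I01)).integral_comp
    (MeasurableEquiv.measurableEmbedding _) (eprod (pend G f) U)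
  rw [← h]
  have h2 : ∀ z : (C → I01) × (P → I01),
      eprod (pend G f) U ((MeasurableEquiv.sumPiEquivProdPi (fun _ : C ⊕ P => I01)).symm z)
      = eprod G U z.1 * ∏ p, U.toFun (z.1 (f p)) (z.2 p) := by
    intro z
    rw [← eprod_pend]
    congr 1
  rw [integral_congr_ae (ae_of_all _ h2)]
  have hb : BM fun z : (C → I01) × (P → I01) =>
      eprod G U z.1 * ∏ p, U.toFun (z.1 (f p)) (z.2 p) := by
    refine ((eprod_bm G U).comp measurable_fst).mul (BM.prod _ fun p _ => U.bm2 ?_ ?_)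
    · exact (measurable_pi_apply _).comp measurable_fst
    · exact (measurable_pi_apply _).comp measurable_snd
  rw [Measure.volume_eq_prod, integral_prod _ (hb.integrable _)]
  congr 1
  ext x
  simp only
  rw [integral_const_mul]
  congr 1
  exact integral_fintype_prod_volume_eq_prod (fun p y => U.toFun (x (f p)) y)

lemma agree_poly {C : Type} [Fintype C] (N : ℕ) (U U' : GKernel)
    (hagree : ∀ n : ℕ, n ≤ N → ∀ H : SimpleGraph (Fin n), homDensity H U' = homDensity H U)
    (G : SimpleGraph C) (P : C → Polynomial ℝ)
    (hP : Fintype.card C + ∑ c, (P c).natDegree ≤ N) :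
    ∫ x, eprod G U' x * ∏ c, (P c).eval (U'.degree (x c)) =
    ∫ x, eprod G U x * ∏ c, (P c).eval (U.degree (x c)) := by
  have key : ∀ V : GKernel, ∫ x, eprod G V x * ∏ c, (P c).eval (V.degree (x c)) =
      ∑ a ∈ Fintype.piFinset (fun c => Finset.range ((P c).natDegree + 1)),
        (∏ c, (P c).coeff (a c)) *
          ∫ x, eprod (pend G (Sigma.fst : (Σ c : C, Fin (a c)) → C)) V x := by
    intro V
    have h1 : ∀ x : C → I01, eprod G V x * ∏ c, (P c).eval (V.degree (x c)) =
        ∑ a ∈ Fintype.piFinset (fun c => Finset.range ((P c).natDegree + 1)),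
        (∏ c, (P c).coeff (a c)) * (eprod G V x * ∏ c, V.degree (x c) ^ (a c)) := by
      intro x
      simp only [Polynomial.eval_eq_sum_range]
      rw [Finset.prod_univ_sum, Finset.mul_sum]
      refine Finset.sum_congr rfl fun a _ => ?_
      rw [Finset.prod_mul_distrib]
      ring
    simp only [h1]
    rw [integral_finsetSum]
    · refine Finset.sum_congr rfl fun a _ => ?_
      rw [integral_const_mul, integral_pend]
      congr 2
      ext x
      congr 1
      rw [← Finset.univ_sigma_univ, Finset.prod_sigma]
      simp
    · intro a _
      refine BM.integrable ?_ _
      refine (BM.const _).mul ((eprod_bm G V).mul (BM.prod _ fun c _ => ?_))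
      exact (V.bm_deg.comp (measurable_pi_apply c)).pow _
  rw [key, key]
  refine Finset.sum_congr rfl fun a ha => ?_
  congr 1
  let e := Fintype.equivFin (C ⊕ (Σ c : C, Fin (a c)))
  rw [← hd_equiv e, ← hd_equiv e]
  apply hagree
  refine le_trans ?_ hP
  rw [Fintype.card_sum, Fintype.card_sigma]
  simp only [Fintype.card_fin]
  gcongr with c _
  have := Fintype.mem_piFinset.1 ha c
  simp at this
  omega

def stepInd {X ι : Type*} (τ : X → ι) (i : ι) (x : X) : ℝ := if τ x = i then 1 else 0

lemma stepInd_bm {X ι : Type*} [MeasurableSpace X] [MeasurableSpace ι] [MeasurableSingletonClass ι]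
    {τ : X → ι} (hτ : Measurable τ) (i : ι) : BM (stepInd τ i) := by
  refine ⟨Measurable.ite (hτ (measurableSet_singleton i)) measurable_const measurable_const, 1,
    fun x => ?_⟩
  unfold stepInd
  split_ifs <;> simp

lemma step_expand {X ι : Type*} [Fintype ι] (τ : X → ι) (v : ι → ℝ) (x : X) :
    v (τ x) = ∑ i, v i * stepInd τ i x := by
  simp [stepInd]

lemma step_bm {X ι : Type*} [MeasurableSpace X] [MeasurableSpace ι] [MeasurableSingletonClass ι]
    [Fintype ι] {τ : X → ι} (hτ : Measurable τ) (v : ι → ℝ) : BM (fun x => v (τ x)) := by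
  simp only [step_expand τ v]
  exact BM.sum _ fun i _ => (BM.const _).mul (stepInd_bm hτ i)

lemma step_integral_mul {X ι : Type*} [MeasurableSpace X] [MeasurableSpace ι]
    [MeasurableSingletonClass ι] [Fintype ι] (μ : Measure X) [IsFiniteMeasure μ]
    {τ : X → ι} (hτ : Measurable τ) (v : ι → ℝ) {f : X → ℝ} (hf : BM f) :
    ∫ x, f x * v (τ x) ∂μ = ∑ i, v i * ∫ x, f x * stepInd τ i x ∂μ := by
  have : ∀ x, f x * v (τ x) = ∑ i, v i * (f x * stepInd τ i x) := by
    intro x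
    rw [step_expand τ v, Finset.mul_sum]
    exact Finset.sum_congr rfl fun i _ => by ring
  simp only [this]
  rw [integral_finsetSum]
  · simp only [integral_const_mul]
  · intro i _
    exact ((BM.const _).mul (hf.mul (stepInd_bm hτ i))).integrable _

lemma step_integral {X ι : Type*} [MeasurableSpace X] [MeasurableSpace ι]
    [MeasurableSingletonClass ι] [Fintype ι] (μ : Measure X) [IsFiniteMeasure μ]
    {τ : X → ι} (hτ : Measurable τ) (v : ι → ℝ) :
    ∫ x, v (τ x) ∂μ = ∑ i, v i * ∫ x, stepInd τ i x ∂μ := by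
  simpa using step_integral_mul μ hτ v (BM.const 1)

lemma ae_zero_of_sq {X : Type*} [MeasurableSpace X] (μ : Measure X) [IsFiniteMeasure μ]
    {f : X → ℝ} (hf : BM f) (h : ∫ x, f x ^ 2 ∂μ = 0) : ∀ᵐ x ∂μ, f x = 0 := by
  have := (integral_eq_zero_iff_of_nonneg (fun x => sq_nonneg (f x)) ((hf.pow 2).integrable μ)).1 h
  filter_upwards [this] with x hx
  simpa using hx

lemma proj_lemma {X ι : Type*} [MeasurableSpace X] [MeasurableSpace ι]
    [MeasurableSingletonClass ι] [Fintype ι] (μ : Measure X) [IsFiniteMeasure μ]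
    {τ : X → ι} (hτ : Measurable τ) (v : ι → ℝ) {f : X → ℝ} (hf : BM f)
    (h1 : ∀ i, ∫ x, f x * stepInd τ i x ∂μ = v i * ∫ x, stepInd τ i x ∂μ)
    (h2 : ∫ x, f x ^ 2 ∂μ = ∑ i, v i ^ 2 * ∫ x, stepInd τ i x ∂μ) :
    ∀ᵐ x ∂μ, f x = v (τ x) := by
  have hv := step_bm hτ v
  have : ∫ x, (f x - v (τ x)) ^ 2 ∂μ = 0 := by
    have e : ∀ x, (f x - v (τ x)) ^ 2 = f x ^ 2 - 2 * (f x * v (τ x)) + v (τ x) ^ 2 := by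
      intro x; ring
    simp only [e]
    rw [integral_add, integral_sub, integral_const_mul, h2, step_integral_mul μ hτ v hf,
      step_integral μ hτ (fun i => v i ^ 2)]
    · simp only [h1]
      rw [Finset.mul_sum, ← Finset.sum_sub_distrib, ← Finset.sum_add_distrib]
      exact Finset.sum_eq_zero fun i _ => by ring
    · exact (hf.pow 2).integrable _
    · exact ((BM.const _).mul (hf.mul hv)).integrable _
    · exact ((hf.pow 2).sub ((BM.const _).mul (hf.mul hv))).integrable _
    · exact (hv.pow 2).integrable _
  filter_upwards [ae_zero_of_sq μ (hf.sub hv) this] with x hx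
  linarith

/-- codegree -/
def GKernel.cod (U : GKernel) (a c : I01) : ℝ := ∫ b, U.toFun a b * U.toFun c b

lemma GKernel.cod_bm (U : GKernel) : BM (fun p : I01 × I01 => U.cod p.1 p.2) := by
  have : BM (fun p : (I01 × I01) × I01 => U.toFun p.1.1 p.2 * U.toFun p.1.2 p.2) :=
    (U.bm2 (by fun_prop) (by fun_prop)).mul (U.bm2 (by fun_prop) (by fun_prop))
  exact this.integral volume

lemma GKernel.cod_symm (U : GKernel) (a c : I01) : U.cod a c = U.cod c a := by
  unfold GKernel.cod
  congr 1; ext b; ring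

lemma fubini_cod (U : GKernel) {h h' : I01 → ℝ} (hh : BM h) (hh' : BM h') :
    ∫ b, (∫ a, U.toFun a b * h a) * (∫ c, U.toFun c b * h' c) =
    ∫ a, ∫ c, U.cod a c * (h a * h' c) := by
  have e : ∀ b, (∫ a, U.toFun a b * h a) * (∫ c, U.toFun c b * h' c) =
      ∫ a, ∫ c, (U.toFun a b * h a) * (U.toFun c b * h' c) := by
    intro b
    simp only [integral_const_mul, integral_mul_const]
  simp only [e]
  have b3 : BM (fun p : (I01 × I01) × I01 =>
      (U.toFun p.1.2 p.1.1 * h p.1.2) * (U.toFun p.2 p.1.1 * h' p.2)) :=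
    ((U.bm2 (by fun_prop) (by fun_prop)).mul (hh.comp (by fun_prop))).mul
      ((U.bm2 (by fun_prop) (by fun_prop)).mul (hh'.comp (by fun_prop)))
  rw [integral_integral_swap ((b3.integral volume).integrable _)]
  congr 1; ext a
  have b2 : BM (fun p : I01 × I01 =>
      (U.toFun a p.1 * h a) * (U.toFun p.2 p.1 * h' p.2)) :=
    ((U.bm2 (by fun_prop) (by fun_prop)).mul (BM.const _)).mul
      ((U.bm2 (by fun_prop) (by fun_prop)).mul (hh'.comp (by fun_prop)))
  rw [integral_integral_swap (b2.integrable _)]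
  congr 1; ext c
  unfold GKernel.cod
  rw [← integral_mul_const]
  congr 1; ext b; ring

lemma ae_zero_of_rect {f : I01 × I01 → ℝ} (hf : BM f)
    (h : ∀ S T : Set I01, MeasurableSet S → MeasurableSet T → ∫ p in S ×ˢ T, f p = 0) :
    ∀ᵐ p, f p = 0 := by
  have hi := hf.integrable (volume : Measure (I01 × I01))
  refine Integrable.ae_eq_zero_of_forall_setIntegral_eq_zero hi fun s hs _ => ?_
  refine MeasurableSpace.induction_on_inter (C := fun s _ => ∫ p in s, f p = 0)
    generateFrom_prod.symm isPiSystem_prod ?_ ?_ ?_ ?_ s hs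
  · simp
  · rintro t ⟨S, hS, T, hT, rfl⟩
    exact h S T hS hT
  · intro t ht h0
    have := integral_add_compl ht hi
    rw [h0, zero_add] at this
    rw [this]
    simpa using h Set.univ Set.univ MeasurableSet.univ MeasurableSet.univ
  · intro F hd hm h0
    rw [integral_iUnion hm hd hi.integrableOn]
    simp [h0]

lemma core {q : ℕ} (σ : I01 → Fin q) (hσ : Measurable σ) (α : Fin q → ℝ)
    (hα : ∀ i, ∫ x, stepInd σ i x = α i) (U W : GKernel) (c : Fin q → Fin q → ℝ)
    (hc : ∀ i j, c i j = c j i)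
    (hW : ∀ x y, W.toFun x y = c (σ x) (σ y))
    (F2 : ∀ i j, ∫ a, ∫ b, U.toFun a b * (stepInd σ i a * stepInd σ j b) = c i j * (α i * α j))
    (F3 : ∀ i j, ∫ a, ∫ b, U.cod a b * (stepInd σ i a * stepInd σ j b)
      = (∑ k, c i k * c j k * α k) * (α i * α j))
    (F4 : ∫ a, ∫ b, U.cod a b ^ 2 = ∑ i, ∑ j, (∑ k, c i k * c j k * α k) ^ 2 * (α i * α j)) :
    ∀ᵐ p : I01 × I01, U.toFun p.1 p.2 = W.toFun p.1 p.2 := by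
  set m : Fin q → Fin q → ℝ := fun i j => ∑ k, c i k * c j k * α k with hm
  have hcod := U.cod_bm
  -- (1)
  have hττ : Measurable (fun p : I01 × I01 => (σ p.1, σ p.2)) := by fun_prop
  have hind : ∀ (i : Fin q × Fin q) (p : I01 × I01), stepInd (fun p : I01 × I01 => (σ p.1, σ p.2)) i p
      = stepInd σ i.1 p.1 * stepInd σ i.2 p.2 := by
    rintro ⟨i, j⟩ ⟨x, y⟩
    simp only [stepInd, Prod.mk.injEq]
    split_ifs <;> simp_all
  have hindI : ∀ i : Fin q × Fin q,
      ∫ p, stepInd (fun p : I01 × I01 => (σ p.1, σ p.2)) i p = α i.1 * α i.2 := by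
    intro i
    simp only [hind, Measure.volume_eq_prod]
    rw [integral_prod_mul, hα, hα]
  have H1 : ∀ᵐ p : I01 × I01, U.cod p.1 p.2 = m (σ p.1) (σ p.2) := by
    refine proj_lemma volume hττ (fun i => m i.1 i.2) hcod ?_ ?_
    · intro i
      rw [hindI, ← F3]
      simp only [hind]
      rw [Measure.volume_eq_prod, integral_prod]
      exact (hcod.mul (((stepInd_bm hσ i.1).comp measurable_fst).mul
        ((stepInd_bm hσ i.2).comp measurable_snd))).integrable _
    · simp only [hindI]
      rw [Fintype.sum_prod_type, ← F4, Measure.volume_eq_prod, integral_prod]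
      exact (hcod.pow 2).integrable _
  -- (2)
  have hg : ∀ i, BM (fun b => ∫ a, U.toFun a b * stepInd σ i a) := by
    intro i
    have : BM (fun p : I01 × I01 => U.toFun p.2 p.1 * stepInd σ i p.2) :=
      (U.bm2 (by fun_prop) (by fun_prop)).mul ((stepInd_bm hσ i).comp measurable_snd)
    exact this.integral volume
  have H2 : ∀ i, ∀ᵐ b, ∫ a, U.toFun a b * stepInd σ i a = c i (σ b) * α i := by
    intro i
    refine proj_lemma volume hσ (fun k => c i k * α i) (hg i) ?_ ?_
    · intro k
      rw [hα, mul_assoc, ← F2, integral_integral_swap]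
      · congr 1; ext b
        rw [← integral_mul_const]
        congr 1; ext a; ring
      · exact ((U.bm2 (by fun_prop) (by fun_prop)).mul (((stepInd_bm hσ i).comp measurable_fst).mul
          ((stepInd_bm hσ k).comp measurable_snd))).integrable _
    · simp only [hα, sq]
      rw [fubini_cod U (stepInd_bm hσ i) (stepInd_bm hσ i), F3, Finset.sum_mul]
      exact Finset.sum_congr rfl fun k _ => by ring
  -- (3)
  have H3 : ∀ᵐ x, ∀ z, ∫ b, U.toFun x b * W.toFun z b = m (σ x) (σ z) := by
    filter_upwards [ae_all_iff.2 H2] with x hx z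
    simp only [hW]
    rw [step_integral_mul volume hσ (c (σ z)) (f := fun b => U.toFun x b)
      (U.bm2 measurable_const measurable_id)]
    refine Finset.sum_congr rfl fun k _ => ?_
    have := hx k
    simp only [U.symm' _ x] at this
    rw [this, hc k (σ x)]
    ring
  have H3' : ∀ x z, ∫ b, W.toFun x b * W.toFun z b = m (σ x) (σ z) := by
    intro x z
    simp only [hW]
    rw [step_integral volume hσ (fun k => c (σ x) k * c (σ z) k)]
    simp only [hα, hm]
  let R : GKernel :=
    { toFun := fun x y => U.toFun x y - W.toFun x y
      measurable' := (U.bm.sub W.bm).1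
      bounded' := by
        obtain ⟨C, hC⟩ := (U.bm.sub W.bm).2
        exact ⟨C, fun x y => hC (x, y)⟩
      symm' := fun x y => by rw [U.symm', W.symm'] }
  have H4 : ∀ᵐ p : I01 × I01, R.cod p.1 p.2 = 0 := by
    have h3a : ∀ᵐ p : I01 × I01, ∀ z, ∫ b, U.toFun p.1 b * W.toFun z b = m (σ p.1) (σ z) :=
      Measure.quasiMeasurePreserving_fst.ae H3
    have h3b : ∀ᵐ p : I01 × I01, ∀ z, ∫ b, U.toFun p.2 b * W.toFun z b = m (σ p.2) (σ z) :=
      Measure.quasiMeasurePreserving_snd.ae H3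
    filter_upwards [H1, h3a, h3b] with p h1 ha hb
    obtain ⟨x, z⟩ := p
    have e : ∀ b, R.toFun x b * R.toFun z b = U.toFun x b * U.toFun z b - U.toFun x b * W.toFun z b
        - U.toFun z b * W.toFun x b + W.toFun x b * W.toFun z b := by
      intro b
      change (U.toFun x b - W.toFun x b) * (U.toFun z b - W.toFun z b) = _
      ring
    have bm : ∀ (V V' : GKernel) (x z : I01), BM (fun b => V.toFun x b * V'.toFun z b) :=
      fun V V' x z => (V.bm2 measurable_const measurable_id).mul
        (V'.bm2 measurable_const measurable_id)
    change ∫ b, R.toFun x b * R.toFun z b = 0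
    simp only [e]
    rw [integral_add, integral_sub, integral_sub]
    · have h1' : ∫ b, U.toFun x b * U.toFun z b = m (σ x) (σ z) := h1
      rw [h1', ha z, hb x, H3']
      have : m (σ z) (σ x) = m (σ x) (σ z) := Finset.sum_congr rfl fun k _ => by ring
      rw [this]
      ring
    · exact (bm U U x z).integrable _
    · exact (bm U W x z).integrable _
    · exact ((bm U U x z).sub (bm U W x z)).integrable _
    · exact (bm U W z x).integrable _
    · exact (((bm U U x z).sub (bm U W x z)).sub (bm U W z x)).integrable _
    · exact (bm W W x z).integrable _
  have H5 : ∀ h : I01 → ℝ, BM h → ∀ᵐ b, ∫ a, R.toFun a b * h a = 0 := by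
    intro h hh
    have hb : BM (fun b => ∫ a, R.toFun a b * h a) := by
      have : BM (fun p : I01 × I01 => R.toFun p.2 p.1 * h p.2) :=
        (R.bm2 (by fun_prop) (by fun_prop)).mul (hh.comp measurable_snd)
      exact this.integral volume
    refine ae_zero_of_sq volume hb ?_
    simp only [sq]
    rw [fubini_cod R hh hh]
    have := integral_prod (μ := (volume : Measure I01)) (ν := (volume : Measure I01))
      (fun p : I01 × I01 => R.cod p.1 p.2 * (h p.1 * h p.2))
      ((R.cod_bm.mul ((hh.comp measurable_fst).mul (hh.comp measurable_snd))).integrable _)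
    rw [← this]
    refine integral_eq_zero_of_ae ?_
    filter_upwards [H4] with p hp
    simp [hp]
  have H6 : ∀ᵐ p : I01 × I01, R.toFun p.1 p.2 = 0 := by
    refine ae_zero_of_rect (f := fun p => R.toFun p.1 p.2) R.bm fun S T hS hT => ?_
    have hT' : BM (T.indicator (1 : I01 → ℝ)) := by
      refine ⟨measurable_one.indicator hT, 1, fun x => ?_⟩
      by_cases hx : x ∈ T <;> simp [hx]
    rw [Measure.volume_eq_prod, setIntegral_prod]
    · refine integral_eq_zero_of_ae (ae_restrict_of_ae ?_)
      filter_upwards [H5 _ hT'] with b hb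
      simp only [Pi.zero_apply]
      rw [← integral_indicator hT]
      refine Eq.trans ?_ hb
      congr 1
      ext a
      rw [R.symm' a b]
      by_cases ha : a ∈ T <;> simp [ha]
    · exact ((R.bm2 measurable_fst measurable_snd).integrable _).integrableOn
  filter_upwards [H6] with p hp
  have : U.toFun p.1 p.2 - W.toFun p.1 p.2 = 0 := hp
  linarith

lemma integral_fin_succ {n : ℕ} {f : (Fin (n + 1) → I01) → ℝ} (hf : BM f) :
    ∫ x, f x = ∫ a, ∫ y : Fin n → I01, f (Matrix.vecCons a y) := by
  have h := (volume_preserving_piFinSuccAbove (fun _ : Fin (n + 1) => I01) 0).symm.integral_comp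
    (MeasurableEquiv.measurableEmbedding _) f
  rw [← h, Measure.volume_eq_prod, integral_prod]
  · congr 1; ext a
    congr 1; ext y
    congr 1
    simp [MeasurableEquiv.piFinSuccAbove, Matrix.vecCons]
    rfl
  · exact (hf.comp (MeasurableEquiv.measurable _)).integrable _

lemma cons_meas {n : ℕ} (a : I01) :
    Measurable (fun y : Fin n → I01 => (Matrix.vecCons a y : Fin (n + 1) → I01)) := by
  refine measurable_pi_lambda _ fun i => ?_
  refine Fin.cases ?_ (fun j => ?_) i
  · simp
  · simpa using measurable_pi_apply j

lemma integral_fin_two {f : (Fin 2 → I01) → ℝ} (hf : BM f) :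
    ∫ x, f x = ∫ a, ∫ b, f ![a, b] := by
  rw [integral_fin_succ hf]
  congr 1; ext a
  rw [integral_fin_succ (hf.comp (cons_meas a))]
  congr 1; ext b
  simp [integral_unique]
  congr

lemma integral_fin_three {f : (Fin 3 → I01) → ℝ} (hf : BM f) :
    ∫ x, f x = ∫ a, ∫ b, ∫ c, f ![a, b, c] := by
  rw [integral_fin_succ hf]
  congr 1; ext a
  rw [integral_fin_two (hf.comp (cons_meas a))]

lemma integral_fin_four {f : (Fin 4 → I01) → ℝ} (hf : BM f) :
    ∫ x, f x = ∫ a, ∫ b, ∫ c, ∫ d, f ![a, b, c, d] := by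
  rw [integral_fin_succ hf]
  congr 1; ext a
  rw [integral_fin_three (hf.comp (cons_meas a))]

lemma eprod_fromEdge {V : Type*} [Fintype V] (U : GKernel) (s : Finset (Sym2 V))
    (hs : ∀ e ∈ s, ¬ e.IsDiag) (x : V → I01) :
    eprod (SimpleGraph.fromEdgeSet (s : Set (Sym2 V))) U x = ∏ e ∈ s,
      Sym2.lift ⟨fun u v => U.toFun (x u) (x v), fun _ _ => U.symm' _ _⟩ e := by
  unfold eprod
  refine Finset.prod_congr ?_ fun _ _ => rfl
  ext e
  simp only [Set.Finite.mem_toFinset, SimpleGraph.edgeSet_fromEdgeSet, Set.mem_sdiff,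
    Finset.mem_coe]
  constructor
  · exact fun h => h.1
  · exact fun h => ⟨h, hs e h⟩

section agree

variable (N : ℕ) (U U' : GKernel)
    (hagree : ∀ n : ℕ, n ≤ N → ∀ H : SimpleGraph (Fin n), homDensity H U' = homDensity H U)

lemma pbm {n : ℕ} (G : SimpleGraph (Fin n)) (V : GKernel) (P : Fin n → Polynomial ℝ) :
    BM fun x => eprod G V x * ∏ c, (P c).eval (V.degree (x c)) :=
  (eprod_bm G V).mul (BM.prod _ fun c _ => (V.bm_deg.comp (measurable_pi_apply c)).polyEval (P c))

include hagree

lemma agree1 (P : Polynomial ℝ) (hP : 1 + P.natDegree ≤ N) :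
    ∫ x, P.eval (U'.degree x) = ∫ x, P.eval (U.degree x) := by
  have h := agree_poly (C := Fin 1) N U U' hagree ⊥ (fun _ => P) (by simpa using hP)
  have key : ∀ V : GKernel, ∫ x, eprod (⊥ : SimpleGraph (Fin 1)) V x *
      ∏ c, P.eval (V.degree (x c)) = ∫ x, P.eval (V.degree x) := by
    intro V
    rw [integral_fin_succ (pbm _ V fun _ => P)]
    congr 1; ext a
    simp [integral_unique, eprod]
  rwa [key, key] at h

lemma agree2 (P Q : Polynomial ℝ) (hP : 2 + (P.natDegree + Q.natDegree) ≤ N) :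
    ∫ a, ∫ b, U'.toFun a b * (P.eval (U'.degree a) * Q.eval (U'.degree b)) =
    ∫ a, ∫ b, U.toFun a b * (P.eval (U.degree a) * Q.eval (U.degree b)) := by
  have h := agree_poly (C := Fin 2) N U U' hagree
    (SimpleGraph.fromEdgeSet (({s(0, 1)} : Finset (Sym2 (Fin 2))) : Set (Sym2 (Fin 2))))
    ![P, Q] (by simpa [Fin.sum_univ_two] using hP)
  rw [integral_fin_two (pbm _ U' _), integral_fin_two (pbm _ U _)] at h
  simp only [eprod_fromEdge _ _ (show ∀ e ∈ ({s(0, 1)} : Finset (Sym2 (Fin 2))), ¬ e.IsDiag by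
    simp)] at h
  simpa [Fin.prod_univ_two] using h

lemma agree3 (P Q : Polynomial ℝ) (hP : 3 + (P.natDegree + Q.natDegree) ≤ N) :
    ∫ a, ∫ b, U'.cod a b * (P.eval (U'.degree a) * Q.eval (U'.degree b)) =
    ∫ a, ∫ b, U.cod a b * (P.eval (U.degree a) * Q.eval (U.degree b)) := by
  have h := agree_poly (C := Fin 3) N U U' hagree
    (SimpleGraph.fromEdgeSet (({s(0, 2), s(1, 2)} : Finset (Sym2 (Fin 3))) : Set (Sym2 (Fin 3))))
    ![P, Q, 1] (by simpa [Fin.sum_univ_three] using hP)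
  rw [integral_fin_three (pbm _ U' _), integral_fin_three (pbm _ U _)] at h
  simp only [eprod_fromEdge _ _ (show ∀ e ∈ ({s(0, 2), s(1, 2)} : Finset (Sym2 (Fin 3))),
    ¬ e.IsDiag by simp)] at h
  simp only [Finset.prod_insert (show s((0 : Fin 3), 2) ∉ ({s(1, 2)} : Finset (Sym2 (Fin 3))) by
    simp), Finset.prod_singleton, Fin.prod_univ_three] at h
  simp only [GKernel.cod, ← integral_mul_const]
  simpa using h

lemma agree4 (hN : 4 ≤ N) :
    ∫ a, ∫ b, U'.cod a b ^ 2 = ∫ a, ∫ b, U.cod a b ^ 2 := by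
  have h := agree_poly (C := Fin 4) N U U' hagree
    (SimpleGraph.fromEdgeSet (({s(0, 2), s(1, 2), s(0, 3), s(1, 3)} : Finset (Sym2 (Fin 4))) :
      Set (Sym2 (Fin 4))))
    (fun _ => 1) (by simpa using hN)
  rw [integral_fin_four (pbm _ U' _), integral_fin_four (pbm _ U _)] at h
  simp only [eprod_fromEdge _ _ (show ∀ e ∈ ({s(0, 2), s(1, 2), s(0, 3), s(1, 3)} :
    Finset (Sym2 (Fin 4))), ¬ e.IsDiag by simp)] at h
  simp only [Finset.prod_insert (show s((0 : Fin 4), 2) ∉ ({s(1, 2), s(0, 3), s(1, 3)} :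
      Finset (Sym2 (Fin 4))) by simp),
    Finset.prod_insert (show s((1 : Fin 4), 2) ∉ ({s(0, 3), s(1, 3)} :
      Finset (Sym2 (Fin 4))) by simp),
    Finset.prod_insert (show s((0 : Fin 4), 3) ∉ ({s(1, 3)} :
      Finset (Sym2 (Fin 4))) by simp),
    Finset.prod_singleton] at h
  have e : ∀ (V : GKernel) (a b : I01), V.cod a b ^ 2 =
      ∫ c, ∫ d, V.toFun a c * (V.toFun b c * (V.toFun a d * V.toFun b d)) := by
    intro V a b
    simp only [← mul_assoc]
    simp only [mul_assoc (V.toFun a _ * V.toFun b _), integral_const_mul, integral_mul_const]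
    rw [sq]; rfl
  simp only [e]
  simpa [mul_assoc] using h

end agree

lemma pair_ae {n : ℕ} {u v : Fin n} (huv : u ≠ v) {p : I01 × I01 → Prop}
    (h : ∀ᵐ z, p z) : ∀ᵐ x : Fin n → I01, p (x u, x v) := by
  have hi := (ProbabilityTheory.iIndepFun_pi (μ := fun _ : Fin n => (volume : Measure I01))
    (X := fun _ => id) (fun _ => aemeasurable_id)).indepFun huv
  have hm := (ProbabilityTheory.indepFun_iff_map_prod_eq_prod_map_map
    (measurable_pi_apply u).aemeasurable (measurable_pi_apply v).aemeasurable).1 hi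
  have e : ∀ w : Fin n, Measure.map (fun x : Fin n → I01 => x w)
      (Measure.pi fun _ : Fin n => (volume : Measure I01)) = volume :=
    fun w => (measurePreserving_eval (fun _ : Fin n => (volume : Measure I01)) w).map_eq
  rw [e, e] at hm
  have : MeasurePreserving (fun x : Fin n → I01 => (x u, x v)) volume volume :=
    ⟨by fun_prop, hm⟩
  exact this.quasiMeasurePreserving.ae h

lemma homDensity_ae (U W : GKernel) (h : ∀ᵐ p : I01 × I01, U.toFun p.1 p.2 = W.toFun p.1 p.2)
    {n : ℕ} (H : SimpleGraph (Fin n)) : homDensity H U = homDensity H W := by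
  have : ∀ᵐ x : Fin n → I01, ∀ u v : Fin n, u ≠ v → U.toFun (x u) (x v) = W.toFun (x u) (x v) := by
    refine ae_all_iff.2 fun u => ae_all_iff.2 fun v => ?_
    by_cases huv : u = v
    · simp [huv]
    · filter_upwards [pair_ae huv h] with x hx _
      exact hx
  refine integral_congr_ae ?_
  filter_upwards [this] with x hx
  refine Finset.prod_congr rfl fun e he => ?_
  induction e using Sym2.ind with
  | _ u v =>
    simp only [Set.Finite.mem_toFinset, SimpleGraph.mem_edgeSet] at he
    exact hx u v he.ne

lemma homDensity_step {q : ℕ} (U W : GKernel) (σ τ : I01 → Fin q) (hσ : Measurable σ)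
    (hτ : Measurable τ) (hm : ∀ i, ∫ x, stepInd σ i x = ∫ x, stepInd τ i x)
    (c : Fin q → Fin q → ℝ) (hU : ∀ x y, U.toFun x y = c (σ x) (σ y))
    (hW : ∀ x y, W.toFun x y = c (τ x) (τ y)) {n : ℕ} (H : SimpleGraph (Fin n)) :
    homDensity H U = homDensity H W := by
  have key : ∀ (V : GKernel) (ρ : I01 → Fin q), Measurable ρ →
      (∀ x y, V.toFun x y = c (ρ x) (ρ y)) → homDensity H V =
      ∑ i : Fin n → Fin q, (∏ e ∈ (Set.toFinite H.edgeSet).toFinset,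
        c (i e.out.1) (i e.out.2)) * ∏ k, ∫ x, stepInd ρ (i k) x := by
    intro V ρ hρ hV
    rw [homDensity_eq]
    have e1 : ∀ x : Fin n → I01, eprod H V x = (fun i : Fin n → Fin q =>
        ∏ e ∈ (Set.toFinite H.edgeSet).toFinset, c (i e.out.1) (i e.out.2)) (fun k => ρ (x k)) := by
      intro x
      refine Finset.prod_congr rfl fun e _ => ?_
      rw [← hV]
      conv_lhs => rw [← Quot.out_eq e]
      rfl
    have hρ' : Measurable (fun (x : Fin n → I01) k => ρ (x k)) := by fun_prop
    simp only [e1]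
    rw [step_integral volume hρ' (fun i : Fin n → Fin q =>
        ∏ e ∈ (Set.toFinite H.edgeSet).toFinset, c (i e.out.1) (i e.out.2))]
    refine Finset.sum_congr rfl fun i _ => ?_
    congr 1
    rw [← integral_fintype_prod_volume_eq_prod (fun k x => stepInd ρ (i k) x)]
    congr 1; ext x
    simp only [stepInd]
    by_cases hx : (fun k => ρ (x k)) = i
    · have hx' : ∀ k, ρ (x k) = i k := fun k => congrFun hx k
      rw [if_pos hx]
      exact (Finset.prod_eq_one fun k _ => if_pos (hx' k)).symm
    · rw [if_neg hx]
      obtain ⟨k, hk⟩ := Function.ne_iff.1 hx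
      exact (Finset.prod_eq_zero (Finset.mem_univ k) (if_neg hk)).symm
  rw [key U σ hσ hU, key W τ hτ hW]
  simp only [hm]

theorem statement2 (q : ℕ) (hq : 2 ≤ q) (U : GKernel) (A : Fin q → Set I01)
    (hA : IsStepPartition U A) (hmin : ¬ HasStepPartition U (q - 1))
    (d : Fin q → ℝ) (hdeg : ∀ i, ∀ x ∈ A i, U.degree x = d i)
    (hdist : Function.Injective d)
    (U' : GKernel)
    (hagree : ∀ n : ℕ, n ≤ 2 * q + 1 → ∀ H : SimpleGraph (Fin n),
      homDensity H U' = homDensity H U) :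
    WeaklyIsomorphic U U' := by
  obtain ⟨hAm, hApos, -, hAu, hAc⟩ := hA
  have hne : ∀ i, (A i).Nonempty := fun i => nonempty_of_measure_ne_zero (hApos i).ne'
  choose r hr using hne
  choose c0 hc0 using hAc
  let c : Fin q → Fin q → ℝ := fun i j => U.toFun (r i) (r j)
  have hex : ∀ x, ∃ i, x ∈ A i := fun x => by
    have : x ∈ ⋃ i, A i := by rw [hAu]; trivial
    simpa using this
  let i0 : Fin q := ⟨0, by omega⟩
  -- classification by degree
  let s : ℝ → Fin q := Function.extend d id (fun _ => i0)
  have hs : ∀ i, s (d i) = i := fun i => by simp [s, hdist.extend_apply]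
  have hsm : Measurable s := by
    have hd : MeasurableEmbedding d :=
      { injective := hdist
        measurable := measurable_of_countable d
        measurableSet_image' := fun _ _ => (Set.toFinite _).measurableSet }
    exact hd.measurable_extend measurable_id measurable_const
  let σ : I01 → Fin q := fun x => s (U.degree x)
  let σ' : I01 → Fin q := fun x => s (U'.degree x)
  have hσ : Measurable σ := hsm.comp U.bm_deg.1
  have hσ' : Measurable σ' := hsm.comp U'.bm_deg.1
  have hσA : ∀ x, x ∈ A (σ x) := by
    intro x
    obtain ⟨i, hi⟩ := hex x
    have : σ x = i := by simp only [σ]; rw [hdeg i x hi, hs]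
    rwa [this]
  have hdσ : ∀ x, U.degree x = d (σ x) := fun x => hdeg _ x (hσA x)
  have hU : ∀ x y, U.toFun x y = c (σ x) (σ y) := fun x y => by
    rw [hc0 _ _ x (hσA x) y (hσA y)]
    exact (hc0 _ _ _ (hr _) _ (hr _)).symm
  -- degrees of U'
  have hdσ' : ∀ᵐ x, U'.degree x = d (σ' x) := by
    let P : Polynomial ℝ := ∏ i, (Polynomial.X - Polynomial.C (d i))
    have hPdeg : P.natDegree = q := by simp [P]
    have h := agree1 _ U U' hagree (P ^ 2) (by
      have := Polynomial.natDegree_pow_le (p := P) (n := 2)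
      omega)
    have hz : ∀ x, P.eval (U.degree x) = 0 := by
      intro x
      rw [hdσ x]
      simp only [P, Polynomial.eval_prod]
      exact Finset.prod_eq_zero (Finset.mem_univ (σ x)) (by simp)
    simp only [Polynomial.eval_pow, hz] at h
    have h := ae_zero_of_sq volume (U'.bm_deg.polyEval P) (by simpa using h)
    filter_upwards [h] with x hx
    simp only [P, Polynomial.eval_prod] at hx
    obtain ⟨i, -, hi⟩ := Finset.prod_eq_zero_iff.1 hx
    have : U'.degree x = d i := by simpa [sub_eq_zero] using hi
    simp only [σ', this, hs]
  let L : Fin q → Polynomial ℝ := fun i => Lagrange.basis Finset.univ d i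
  have hL : ∀ i j, (L i).eval (d j) = if j = i then 1 else 0 := by
    intro i j
    split_ifs with h
    · subst h
      exact Lagrange.eval_basis_self hdist.injOn (Finset.mem_univ _)
    · exact Lagrange.eval_basis_of_ne (Ne.symm h) (Finset.mem_univ _)
  have hLdeg : ∀ i, (L i).natDegree ≤ q - 1 := by
    intro i
    have := Lagrange.degree_basis (s := Finset.univ) hdist.injOn (Finset.mem_univ i)
    rw [Polynomial.natDegree_eq_of_degree_eq_some this]
    simp
  have hLU : ∀ i x, (L i).eval (U.degree x) = stepInd σ i x := by
    intro i x; rw [hdσ, hL]; simp [stepInd]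
  have hLU' : ∀ᵐ x, ∀ i, (L i).eval (U'.degree x) = stepInd σ' i x := by
    filter_upwards [hdσ'] with x hx i
    rw [hx, hL]; simp [stepInd]
  let α : Fin q → ℝ := fun i => ∫ x, stepInd σ i x
  have hα : ∀ i, ∫ x, stepInd σ' i x = α i := by
    intro i
    have h := agree1 _ U U' hagree (L i) (by have := hLdeg i; omega)
    simp only [hLU] at h
    refine Eq.trans ?_ h
    refine integral_congr_ae ?_
    filter_upwards [hLU'] with x hx
    rw [hx]
  have hpush : ∀ (k : I01 → I01 → ℝ) i j,
      ∫ a, ∫ b, k a b * ((L i).eval (U'.degree a) * (L j).eval (U'.degree b)) =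
      ∫ a, ∫ b, k a b * (stepInd σ' i a * stepInd σ' j b) := by
    intro k i j
    refine integral_congr_ae ?_
    filter_upwards [hLU'] with a ha
    refine integral_congr_ae ?_
    filter_upwards [hLU'] with b hb
    rw [ha, hb]
  have hdouble : ∀ v : Fin q → Fin q → ℝ, ∫ a, ∫ b, v (σ a) (σ b) =
      ∑ i, ∑ j, v i j * (α i * α j) := by
    intro v
    have : ∀ a, ∫ b, v (σ a) (σ b) = (fun i => ∑ j, v i j * α j) (σ a) :=
      fun a => step_integral volume hσ (v (σ a))
    simp only [this]
    rw [step_integral volume hσ (fun i => ∑ j, v i j * α j)]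
    refine Finset.sum_congr rfl fun i _ => ?_
    rw [Finset.sum_mul]
    refine Finset.sum_congr rfl fun j _ => ?_
    simp only [α]; ring
  have hdouble' : ∀ (v : Fin q → Fin q → ℝ) i j,
      ∫ a, ∫ b, v (σ a) (σ b) * (stepInd σ i a * stepInd σ j b) = v i j * (α i * α j) := by
    intro v i j
    have := hdouble (fun k l => v k l * ((if k = i then 1 else 0) * (if l = j then 1 else 0)))
    refine Eq.trans ?_ (this.trans ?_)
    · simp [stepInd]
    · simp
  have hcod : ∀ a b, U.cod a b = (fun i j => ∑ k, c i k * c j k * α k) (σ a) (σ b) := by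
    intro a b
    simp only [GKernel.cod, hU]
    exact step_integral volume hσ (fun k => c (σ a) k * c (σ b) k)
  let W : GKernel :=
    { toFun := fun x y => c (σ' x) (σ' y)
      measurable' := by
        have : Measurable (Function.uncurry c) := measurable_of_countable _
        exact this.comp (f := fun p : I01 × I01 => (σ' p.1, σ' p.2)) (by fun_prop)
      bounded' := by
        obtain ⟨C, hC⟩ := U.bounded'
        exact ⟨C, fun x y => hC _ _⟩
      symm' := fun x y => U.symm' _ _ }
  have hae := core σ' hσ' α hα U' W c (fun i j => U.symm' _ _) (fun _ _ => rfl)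
    (by
      intro i j
      have h := agree2 _ U U' hagree (L i) (L j) (by have := hLdeg i; have := hLdeg j; omega)
      rw [hpush] at h
      rw [h]
      simp only [hLU, hU]
      exact hdouble' c i j)
    (by
      intro i j
      have h := agree3 _ U U' hagree (L i) (L j) (by have := hLdeg i; have := hLdeg j; omega)
      rw [hpush] at h
      rw [h]
      simp only [hLU, hcod]
      exact hdouble' (fun i j => ∑ k, c i k * c j k * α k) i j)
    (by
      rw [agree4 _ U U' hagree (by omega)]
      simp only [hcod]
      exact hdouble (fun i j => (∑ k, c i k * c j k * α k) ^ 2))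
  intro n H
  rw [homDensity_ae U' W hae H]
  exact homDensity_step U W σ σ' hσ hσ' (fun i => (hα i).symm) c hU (fun _ _ => rfl) H

end
end

section
/- For every integer q ≥ 1 and every kernel U the following are equivalent: (a) ∫_{[0,1]^{2(q+1)}} ∏_{1≤i<j≤q+1} ( ∫_{[0,1]} (U(x_i,y)−U(x_j,y))·(U(x'_i,y)−U(x'_j,y)) dy )² dx₁…dx_{q+1} dx'₁…dx'_{q+1} = 0; (b) U is weakly isomorphic to a step kernel with at most q parts, i.e., to a kernel V for which [0,1] can be partitioned into at most q measurable sets of positive measure with V constant on each product of two parts. -/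
open MeasureTheory
open scoped BigOperators Classical

noncomputable section

theorem GKernel.meas_comp (U : GKernel) {α : Type*} [MeasurableSpace α] {f g : α → I01}
    (hf : Measurable f) (hg : Measurable g) : Measurable (fun a => U.toFun (f a) (g a)) :=
  U.measurable'.comp (hf.prodMk hg)

theorem hom_eq {W K : Type} [Fintype W] [Fintype K] (a b : K → W) (hab : ∀ k, a k ≠ b k)
    (hinj : Function.Injective (fun k => s(a k, b k))) :
    ∃ (n : ℕ) (H : SimpleGraph (Fin n)), ∀ U : GKernel,
      ∫ z : W → I01, ∏ k, U.toFun (z (a k)) (z (b k)) = homDensity H U := by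
  let e : W ≃ Fin (Fintype.card W) := Fintype.equivFin W
  let f : K → Sym2 (Fin (Fintype.card W)) := fun k => s(e (a k), e (b k))
  have hf : Function.Injective f := by
    intro k l h
    apply hinj
    have h2 : f = fun k => Sym2.map e s(a k, b k) := by
      funext k; simp [f]
    rw [h2] at h
    exact Sym2.map.injective e.injective h
  refine ⟨Fintype.card W, SimpleGraph.fromEdgeSet (Set.range f), fun U => ?_⟩
  have hE : (Set.toFinite (SimpleGraph.fromEdgeSet (Set.range f)).edgeSet).toFinset
      = Finset.univ.image f := by
    ext x
    simp only [SimpleGraph.edgeSet_fromEdgeSet, Set.Finite.mem_toFinset, Set.mem_sdiff,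
      Set.mem_range, Finset.mem_image, Finset.mem_univ, true_and]
    constructor
    · exact fun h => h.1
    · rintro ⟨k, rfl⟩
      refine ⟨⟨k, rfl⟩, ?_⟩
      simp [f, hab]
  unfold homDensity
  rw [hE]
  simp_rw [Finset.prod_image (fun x _ y _ h => hf h)]
  rw [← (volume_measurePreserving_piCongrLeft (fun _ : Fin (Fintype.card W) => I01)
    e).integral_comp (MeasurableEquiv.measurableEmbedding _)]
  congr 1
  funext z
  refine Finset.prod_congr rfl fun k _ => ?_
  have : ∀ w, (MeasurableEquiv.piCongrLeft (fun _ : Fin (Fintype.card W) => I01) e) z (e w) = z w :=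
    fun w => Equiv.piCongrLeft_apply_apply (fun _ : Fin (Fintype.card W) => I01) e z w
  simp only [f, Sym2.lift_mk, this]

def QI (m : ℕ) (U : GKernel) : ℝ :=
  ∫ x : (Fin m → I01) × (Fin m → I01),
        ∏ i : Fin m, ∏ j ∈ Finset.Ioi i,
          (∫ y : I01, (U.toFun (x.1 i) y - U.toFun (x.1 j) y) *
            (U.toFun (x.2 i) y - U.toFun (x.2 j) y)) ^ 2

abbrev PS (m : ℕ) : Type :=
  ((Finset.univ : Finset (Fin m)).sigma (fun i => Finset.Ioi i) : Finset (Σ _ : Fin m, Fin m)) × Fin 2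

def sg (b : Bool) : ℝ := cond b 1 (-1)

theorem expand1 {m : ℕ} (A B : Fin m → ℝ) (i j : Fin m) :
    (A i - A j) * (B i - B j) =
      ∑ t : Bool × Bool, (sg t.1 * sg t.2) * (A (cond t.1 i j) * B (cond t.2 i j)) := by
  rw [Fintype.sum_prod_type]
  simp [sg]
  ring

theorem bound_prod {K : Type} [Fintype K] (f : K → ℝ) (C : ℝ) (h : ∀ k, |f k| ≤ C) :
    ‖∏ k, f k‖ ≤ C ^ Fintype.card K := by
  rw [Real.norm_eq_abs, Finset.abs_prod]
  calc _ ≤ ∏ k : K, C := Finset.prod_le_prod (fun _ _ => abs_nonneg _) (fun k _ => h k)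
    _ = _ := by simp

theorem term_integrable {m : ℕ} (U : GKernel) (σ : PS m → Bool × Bool) :
    Integrable (fun z : ((Fin m → I01) × (Fin m → I01)) × (PS m → I01) =>
      ∏ p : PS m, (U.toFun (z.1.1 (cond (σ p).1 p.1.1.1 p.1.1.2)) (z.2 p) *
        U.toFun (z.1.2 (cond (σ p).2 p.1.1.1 p.1.1.2)) (z.2 p))) := by
  obtain ⟨C, hC⟩ := U.bounded'
  refine Integrable.of_bound (Measurable.aestronglyMeasurable ?_) ((C * C) ^ Fintype.card (PS m)) ?_
  · refine Finset.measurable_prod _ fun p _ => ?_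
    exact (U.meas_comp (by fun_prop) (by fun_prop)).mul (U.meas_comp (by fun_prop) (by fun_prop))
  · refine Filter.Eventually.of_forall fun z => ?_
    refine bound_prod _ _ fun p => ?_
    rw [abs_mul]
    exact mul_le_mul (hC _ _) (hC _ _) (abs_nonneg _) ((abs_nonneg _).trans (hC (z.2 p) (z.2 p)))

theorem QI_expand (m : ℕ) (U : GKernel) :
    QI m U = ∑ σ : PS m → Bool × Bool, (∏ p, (sg (σ p).1 * sg (σ p).2)) *
      ∫ z : ((Fin m → I01) × (Fin m → I01)) × (PS m → I01),
        ∏ p : PS m, (U.toFun (z.1.1 (cond (σ p).1 p.1.1.1 p.1.1.2)) (z.2 p) *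
          U.toFun (z.1.2 (cond (σ p).2 p.1.1.1 p.1.1.2)) (z.2 p)) := by
  have h1 : ∀ x : (Fin m → I01) × (Fin m → I01),
      (∏ i : Fin m, ∏ j ∈ Finset.Ioi i,
          (∫ y : I01, (U.toFun (x.1 i) y - U.toFun (x.1 j) y) *
            (U.toFun (x.2 i) y - U.toFun (x.2 j) y)) ^ 2)
      = ∫ y : PS m → I01, ∏ p : PS m,
          ((U.toFun (x.1 p.1.1.1) (y p) - U.toFun (x.1 p.1.1.2) (y p)) *
            (U.toFun (x.2 p.1.1.1) (y p) - U.toFun (x.2 p.1.1.2) (y p))) := by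
    intro x
    rw [integral_fintype_prod_volume_eq_prod (fun (p : PS m) (y : I01) =>
      ((U.toFun (x.1 p.1.1.1) y - U.toFun (x.1 p.1.1.2) y) *
            (U.toFun (x.2 p.1.1.1) y - U.toFun (x.2 p.1.1.2) y)))]
    rw [Fintype.prod_prod_type]
    simp only [Finset.prod_const, Finset.card_univ, Fintype.card_fin]
    rw [Finset.prod_sigma']
    exact (Finset.prod_coe_sort _ (fun p : (Σ _ : Fin m, Fin m) =>
      (∫ y : I01, (U.toFun (x.1 p.1) y - U.toFun (x.1 p.2) y) *
            (U.toFun (x.2 p.1) y - U.toFun (x.2 p.2) y)) ^ 2)).symm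
  have h2 : ∀ (x : (Fin m → I01) × (Fin m → I01)) (y : PS m → I01),
      ∏ p : PS m, ((U.toFun (x.1 p.1.1.1) (y p) - U.toFun (x.1 p.1.1.2) (y p)) *
            (U.toFun (x.2 p.1.1.1) (y p) - U.toFun (x.2 p.1.1.2) (y p)))
      = ∑ σ : PS m → Bool × Bool, (∏ p, (sg (σ p).1 * sg (σ p).2)) *
        ∏ p : PS m, (U.toFun (x.1 (cond (σ p).1 p.1.1.1 p.1.1.2)) (y p) *
          U.toFun (x.2 (cond (σ p).2 p.1.1.1 p.1.1.2)) (y p)) := by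
    intro x y
    simp_rw [← Finset.prod_mul_distrib (f := fun p : PS m => sg _ * sg _)]
    rw [← Fintype.prod_sum (fun (p : PS m) (t : Bool × Bool) => sg t.1 * sg t.2 *
      (U.toFun (x.1 (cond t.1 p.1.1.1 p.1.1.2)) (y p) *
          U.toFun (x.2 (cond t.2 p.1.1.1 p.1.1.2)) (y p)))]
    refine Finset.prod_congr rfl fun p _ => ?_
    exact expand1 (fun i => U.toFun (x.1 i) (y p)) (fun i => U.toFun (x.2 i) (y p)) _ _
  unfold QI
  simp_rw [h1, h2]
  have hint : ∀ σ : PS m → Bool × Bool, Integrable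
    (fun z : ((Fin m → I01) × (Fin m → I01)) × (PS m → I01) =>
      (∏ p, (sg (σ p).1 * sg (σ p).2)) *
      ∏ p : PS m, (U.toFun (z.1.1 (cond (σ p).1 p.1.1.1 p.1.1.2)) (z.2 p) *
        U.toFun (z.1.2 (cond (σ p).2 p.1.1.1 p.1.1.2)) (z.2 p))) :=
    fun σ => (term_integrable U σ).const_mul _
  have h3 := integral_prod _ (integrable_finsetSum Finset.univ (fun σ _ => hint σ))
  refine h3.symm.trans ?_
  rw [← Measure.volume_eq_prod, integral_finsetSum _ (fun σ _ => hint σ)]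
  simp_rw [integral_const_mul]

theorem QI_congr (m : ℕ) {U V : GKernel} (h : WeaklyIsomorphic U V) : QI m U = QI m V := by
  rw [QI_expand, QI_expand]
  refine Finset.sum_congr rfl fun σ _ => ?_
  congr 1
  let W := (Fin m ⊕ Fin m) ⊕ PS m
  let a : PS m × Bool → W := fun k => Sum.inl (cond k.2
    (Sum.inl (cond (σ k.1).1 k.1.1.1.1 k.1.1.1.2)) (Sum.inr (cond (σ k.1).2 k.1.1.1.1 k.1.1.1.2)))
  let b : PS m × Bool → W := fun k => Sum.inr k.1
  obtain ⟨n, H, hH⟩ := hom_eq a b (by intro k; simp [a, b]) (by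
    rintro ⟨k, s⟩ ⟨l, t⟩ h
    simp only [a, b, Sym2.eq_iff, reduceCtorEq, false_and, or_false] at h
    obtain ⟨h1, h2⟩ := h
    have h1 := Sum.inl.inj h1
    have h2 := Sum.inr.inj h2
    subst h2
    cases s <;> cases t <;> simp at h1 ⊢)
  have key : ∀ U : GKernel, (∫ z : ((Fin m → I01) × (Fin m → I01)) × (PS m → I01),
        ∏ p : PS m, (U.toFun (z.1.1 (cond (σ p).1 p.1.1.1 p.1.1.2)) (z.2 p) *
          U.toFun (z.1.2 (cond (σ p).2 p.1.1.1 p.1.1.2)) (z.2 p))) = homDensity H U := by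
    intro U
    rw [← hH U]
    have e1 := volume_measurePreserving_sumPiEquivProdPi (fun _ : (Fin m ⊕ Fin m) ⊕ PS m => I01)
    have e2 := volume_measurePreserving_sumPiEquivProdPi (fun _ : (Fin m ⊕ Fin m) => I01)
    have e3 := e2.prod (MeasurePreserving.id (volume : Measure (PS m → I01)))
    rw [Measure.volume_eq_prod, ← e3.integral_comp
      ((MeasurableEquiv.prodCongr (MeasurableEquiv.sumPiEquivProdPi (fun _ : (Fin m ⊕ Fin m) => I01))
        (MeasurableEquiv.refl _)).measurableEmbedding)]
    rw [← Measure.volume_eq_prod, ← e1.integral_comp (MeasurableEquiv.measurableEmbedding _)]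
    congr 1
    funext z
    refine Eq.trans ?_ (Fintype.prod_prod_type _).symm
    refine Finset.prod_congr rfl fun p _ => ?_
    rw [Fintype.prod_bool]
    rfl
  rw [key U, key V, h]

theorem QI_step (q q' : ℕ) (hq : q' ≤ q) (V : GKernel) (h : HasStepPartition V q') :
    QI (q + 1) V = 0 := by
  obtain ⟨A, hA1, hA2, hA3, hA4, hA5⟩ := h
  have hc : ∀ x : I01, ∃ i, x ∈ A i := fun x => by
    have : x ∈ ⋃ i, A i := by rw [hA4]; trivial
    simpa using this
  choose c hc using hc
  unfold QI
  have : ∀ x : (Fin (q + 1) → I01) × (Fin (q + 1) → I01),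
        ∏ i : Fin (q + 1), ∏ j ∈ Finset.Ioi i,
          (∫ y : I01, (V.toFun (x.1 i) y - V.toFun (x.1 j) y) *
            (V.toFun (x.2 i) y - V.toFun (x.2 j) y)) ^ 2 = 0 := by
    intro x
    have key : ∀ i j, c (x.1 i) = c (x.1 j) → ∀ y, V.toFun (x.1 i) y = V.toFun (x.1 j) y := by
      intro i j hij y
      obtain ⟨v, hv⟩ := hA5 (c (x.1 i)) (c y)
      rw [hv _ (hc _) _ (hc _), hv _ (hij ▸ hc _) _ (hc _)]
    have : ∃ i j, i < j ∧ c (x.1 i) = c (x.1 j) := by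
      obtain ⟨i, j, hne, hij⟩ := Fintype.exists_ne_map_eq_of_card_lt (fun i => c (x.1 i))
        (by simp; omega)
      rcases lt_or_gt_of_ne hne with h | h
      · exact ⟨i, j, h, hij⟩
      · exact ⟨j, i, h, hij.symm⟩
    obtain ⟨i, j, hlt, hij⟩ := this
    refine Finset.prod_eq_zero (Finset.mem_univ i) (Finset.prod_eq_zero (Finset.mem_Ioi.2 hlt) ?_)
    simp [key i j hij]
  simp [this]

theorem weak_of_ae {U V : GKernel}
    (h : ∀ᵐ z : I01 × I01, U.toFun z.1 z.2 = V.toFun z.1 z.2) : WeaklyIsomorphic U V := by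
  intro n H
  unfold homDensity
  apply integral_congr_ae
  have hpair : ∀ u v : Fin n, u ≠ v → ∀ᵐ x : Fin n → I01,
      U.toFun (x u) (x v) = V.toFun (x u) (x v) := by
    intro u v huv
    have hi := ((ProbabilityTheory.iIndepFun_pi (μ := fun _ : Fin n => (volume : Measure I01))
      (X := fun _ => id) (fun i => aemeasurable_id)).indepFun huv)
    simp only [id] at hi
    rw [ProbabilityTheory.indepFun_iff_map_prod_eq_prod_map_map
      (f := fun x : Fin n → I01 => x u) (g := fun x : Fin n → I01 => x v)
      (measurable_pi_apply u).aemeasurable (measurable_pi_apply v).aemeasurable] at hi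
    have hu := (measurePreserving_eval (fun _ : Fin n => (volume : Measure I01)) u).map_eq
    have hv := (measurePreserving_eval (fun _ : Fin n => (volume : Measure I01)) v).map_eq
    have hi' : Measure.map (fun x : Fin n → I01 => (x u, x v)) volume
        = (volume : Measure (I01 × I01)) := by
      rw [Measure.volume_eq_prod]
      conv_rhs => rw [← hu]
      conv_rhs => arg 2; rw [hu, ← hv]
      exact hi
    rw [← hi'] at h
    exact ae_of_ae_map (by fun_prop) h
  have hall : ∀ᵐ x : Fin n → I01, ∀ u v : Fin n, u ≠ v →
      U.toFun (x u) (x v) = V.toFun (x u) (x v) := by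
    rw [ae_all_iff]; intro u
    rw [ae_all_iff]; intro v
    by_cases huv : u = v
    · simp [huv]
    · filter_upwards [hpair u v huv] with x hx _ using hx
  filter_upwards [hall] with x hx
  refine Finset.prod_congr rfl fun e he => ?_
  induction e using Sym2.ind with
  | _ u v =>
    simp only [Set.Finite.mem_toFinset, SimpleGraph.mem_edgeSet] at he
    exact hx u v he.ne

abbrev L2I : Type := Lp ℝ 2 (volume : Measure I01)

theorem row_memLp (U : GKernel) (x : I01) : MemLp (U.toFun x) 2 (volume : Measure I01) := by
  obtain ⟨C, hC⟩ := U.bounded'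
  exact MemLp.of_bound (U.meas_comp measurable_const measurable_id).aestronglyMeasurable C
    (Filter.Eventually.of_forall fun y => hC x y)

def rowL (U : GKernel) (x : I01) : L2I := (row_memLp U x).toLp (U.toFun x)

theorem row_inner (U : GKernel) (a b c d : I01) :
    inner ℝ (rowL U a - rowL U b) (rowL U c - rowL U d) =
      ∫ y : I01, (U.toFun a y - U.toFun b y) * (U.toFun c y - U.toFun d y) := by
  rw [L2.inner_def]
  apply integral_congr_ae
  unfold rowL
  filter_upwards [Lp.coeFn_sub (rowL U a) (rowL U b), Lp.coeFn_sub (rowL U c) (rowL U d),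
    (row_memLp U a).coeFn_toLp, (row_memLp U b).coeFn_toLp, (row_memLp U c).coeFn_toLp,
    (row_memLp U d).coeFn_toLp] with y h1 h2 h3 h4 h5 h6
  unfold rowL at h1 h2
  rw [h1, h2, Pi.sub_apply, Pi.sub_apply, h3, h4, h5, h6]
  simp [mul_comm]

theorem row_eq_iff (U : GKernel) (a b : I01) :
    rowL U a = rowL U b ↔ ∀ᵐ y : I01, U.toFun a y = U.toFun b y :=
  MemLp.toLp_eq_toLp_iff _ _

theorem meas_inner (U : GKernel) {α : Type*} [MeasurableSpace α] {a b c d : α → I01}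
    (ha : Measurable a) (hb : Measurable b) (hc : Measurable c) (hd : Measurable d) :
    Measurable (fun x => ∫ y : I01, (U.toFun (a x) y - U.toFun (b x) y) *
      (U.toFun (c x) y - U.toFun (d x) y)) := by
  refine (StronglyMeasurable.integral_prod_right ?_).measurable
  refine Measurable.stronglyMeasurable ?_
  have := fun {f : α → I01} (hf : Measurable f) =>
    U.meas_comp (hf.comp (measurable_fst (β := I01))) (measurable_snd (α := α))
  exact ((this ha).sub (this hb)).mul ((this hc).sub (this hd))

theorem row_meas (U : GKernel) (r : I01) : MeasurableSet {x | rowL U x = rowL U r} := by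
  have : {x | rowL U x = rowL U r} = {x | ∫ y : I01, (U.toFun x y - U.toFun r y) *
      (U.toFun x y - U.toFun r y) = 0} := by
    ext x
    simp only [Set.mem_ofPred_eq]
    rw [← row_inner, inner_self_eq_zero, sub_eq_zero]
  rw [this]
  exact measurableSet_eq_fun
    (meas_inner U measurable_id measurable_const measurable_id measurable_const) measurable_const

theorem QI_integrable (m : ℕ) (U : GKernel) :
    Integrable (fun x : (Fin m → I01) × (Fin m → I01) =>
        ∏ i : Fin m, ∏ j ∈ Finset.Ioi i,
          (∫ y : I01, (U.toFun (x.1 i) y - U.toFun (x.1 j) y) *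
            (U.toFun (x.2 i) y - U.toFun (x.2 j) y)) ^ 2) := by
  obtain ⟨C, hC⟩ := U.bounded'
  refine Integrable.of_bound (Measurable.aestronglyMeasurable ?_)
    (∏ i : Fin m, ∏ j ∈ Finset.Ioi i, ((C + C) * (C + C)) ^ 2) ?_
  · refine Finset.measurable_prod _ fun i _ => Finset.measurable_prod _ fun j _ => ?_
    exact (meas_inner U (by fun_prop) (by fun_prop) (by fun_prop) (by fun_prop)).pow_const 2
  · refine Filter.Eventually.of_forall fun x => ?_
    rw [Real.norm_eq_abs, Finset.abs_prod]
    refine Finset.prod_le_prod (fun _ _ => abs_nonneg _) fun i _ => ?_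
    rw [Finset.abs_prod]
    refine Finset.prod_le_prod (fun _ _ => abs_nonneg _) fun j _ => ?_
    rw [abs_pow]
    refine pow_le_pow_left₀ (abs_nonneg _) ?_ 2
    have hs : ∀ a b y, |U.toFun a y - U.toFun b y| ≤ C + C := fun a b y =>
      (abs_sub _ _).trans (add_le_add (hC _ _) (hC _ _))
    have := norm_integral_le_of_norm_le_const (μ := (volume : Measure I01))
      (f := fun y => (U.toFun (x.1 i) y - U.toFun (x.1 j) y) *
            (U.toFun (x.2 i) y - U.toFun (x.2 j) y)) (C := (C + C) * (C + C))
      (Filter.Eventually.of_forall fun y => by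
        rw [norm_mul]
        exact mul_le_mul (hs _ _ _) (hs _ _ _) (norm_nonneg _)
          ((abs_nonneg _).trans (hs (x.1 i) (x.1 i) y)))
    simpa using this

/-- Points of the essential support are few. -/
theorem support_small (m : ℕ) (U : GKernel) (h0 : QI m U = 0) (f : Fin m → L2I)
    (hf : ∀ i, ∀ u ∈ nhds (f i), volume (rowL U ⁻¹' u) ≠ 0) : ¬ Function.Injective f := by
  intro hinj
  unfold QI at h0
  rw [integral_eq_zero_iff_of_nonneg (fun x => Finset.prod_nonneg fun i _ =>
    Finset.prod_nonneg fun j _ => sq_nonneg _) (QI_integrable m U)] at h0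
  let S : Set ((Fin m → L2I) × (Fin m → L2I)) :=
    {g | ∀ i, ∀ j, i < j → inner ℝ (g.1 i - g.1 j) (g.2 i - g.2 j) ≠ 0}
  have hS : S ∈ nhds (f, f) := by
    have : ∀ᶠ g in nhds (f, f), ∀ i, ∀ j, i < j →
        inner ℝ (g.1 i - g.1 j) (g.2 i - g.2 j) ≠ (0 : ℝ) := by
      rw [Filter.eventually_all]; intro i
      rw [Filter.eventually_all]; intro j
      rw [Filter.eventually_imp_distrib_left]; intro hij
      have hc : Continuous (fun g : (Fin m → L2I) × (Fin m → L2I) =>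
        inner ℝ (g.1 i - g.1 j) (g.2 i - g.2 j)) := by fun_prop
      refine hc.continuousAt.eventually_ne ?_
      simp only [ne_eq, inner_self_eq_zero, sub_eq_zero]
      exact fun h => hij.ne (hinj h)
    exact this
  obtain ⟨u, hu, v, hv, huv⟩ := mem_nhds_prod_iff.1 hS
  rw [nhds_pi, Filter.mem_pi] at hu hv
  obtain ⟨I, -, s, hs, hsu⟩ := hu
  obtain ⟨J, -, t, ht, htv⟩ := hv
  let B : Set (Fin m → I01) := Set.univ.pi fun i => rowL U ⁻¹' (s i ∩ t i)
  have hB : volume (B ×ˢ B) ≠ 0 := by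
    rw [Measure.volume_eq_prod, Measure.prod_prod]
    have : volume B ≠ 0 := by
      rw [volume_pi, Measure.pi_pi]
      exact Finset.prod_ne_zero_iff.2 fun i _ => hf i _ (Filter.inter_mem (hs i) (ht i))
    exact mul_ne_zero this this
  apply hB
  refine measure_mono_null ?_ (ae_iff.1 h0)
  rintro ⟨x, x'⟩ ⟨hx, hx'⟩
  have hmem : ((fun i => rowL U (x i)), (fun i => rowL U (x' i))) ∈ S := by
    apply huv
    exact ⟨hsu fun i _ => (hx i trivial).1, htv fun i _ => (hx' i trivial).2⟩
  simp only [Pi.zero_apply, Set.mem_ofPred_eq]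
  refine Finset.prod_ne_zero_iff.2 fun i _ => Finset.prod_ne_zero_iff.2 fun j hj => ?_
  rw [← row_inner]
  exact pow_ne_zero 2 (hmem i j (Finset.mem_Ioi.1 hj))

theorem exists_classes (q : ℕ) (U : GKernel) (h0 : QI (q + 1) U = 0) :
    ∃ q' : ℕ, q' ≤ q ∧ ∃ c : I01 → Fin q', ∃ r : Fin q' → I01, Measurable c ∧
      (∀ i, volume (c ⁻¹' {i}) ≠ 0) ∧ ∀ᵐ x : I01, rowL U x = rowL U (r (c x)) := by
  have : Fact ((2 : ENNReal) ≠ ⊤) := ⟨by simp⟩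
  let N : Set L2I := {f | ∃ u ∈ nhds f, volume (rowL U ⁻¹' u) = 0}
  have hN : volume (rowL U ⁻¹' N) = 0 := by
    have := measure_null_of_locally_null
      (μ := OuterMeasure.map (rowL U) (volume : Measure I01).toOuterMeasure) N (by
        rintro f ⟨u, hu, h⟩
        exact ⟨u, mem_nhdsWithin_of_mem_nhds hu, by simpa using h⟩)
    simpa using this
  have hsmall : ¬ ∃ f : Fin (q + 1) → (Nᶜ : Set L2I), Function.Injective f := by
    rintro ⟨f, hf⟩
    refine support_small (q + 1) U h0 (fun i => (f i).1) ?_ (Subtype.val_injective.comp hf)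
    intro i u hu h
    exact (f i).2 ⟨u, hu, h⟩
  have hfin : Finite (Nᶜ : Set L2I) := by
    by_contra hinf
    rw [not_finite_iff_infinite] at hinf
    exact hsmall ⟨fun i => Infinite.natEmbedding _ i.1,
      fun i j h => Fin.ext ((Infinite.natEmbedding _).injective h)⟩
  have hfin' : (Nᶜ : Set L2I).Finite := hfin
  let T : Set L2I := {f | f ∈ Nᶜ ∧ volume (rowL U ⁻¹' {f}) ≠ 0}
  have hTN : T ⊆ Nᶜ := fun f hf => hf.1
  have hTfin : T.Finite := hfin'.subset hTN
  have : Fintype T := hTfin.fintype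
  have hcard : Fintype.card T ≤ q := by
    by_contra hlt
    push Not at hlt
    obtain ⟨g⟩ := Function.Embedding.nonempty_of_card_le (α := Fin (q + 1)) (β := T)
      (by simpa using hlt)
    exact hsmall ⟨fun i => ⟨(g i).1, hTN (g i).2⟩, fun i j h =>
      g.injective (Subtype.ext (by simpa using h))⟩
  have haeT : ∀ᵐ x : I01, rowL U x ∈ T := by
    have h1 : ∀ᵐ x : I01, rowL U x ∉ N := by
      exact ae_iff.2 (measure_mono_null (fun x hx => not_not.1 hx) hN)
    have h2 : ∀ᵐ x : I01, ∀ f ∈ Nᶜ, volume (rowL U ⁻¹' {f}) = 0 → rowL U x ≠ f := by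
      rw [ae_ball_iff hfin'.countable]
      intro f _
      by_cases hv : volume (rowL U ⁻¹' {f}) = 0
      · have : ∀ᵐ x : I01, rowL U x ≠ f := by
          exact ae_iff.2 (measure_mono_null (fun x hx => not_not.1 hx) hv)
        filter_upwards [this] with x hx _ using hx
      · simp [hv]
    filter_upwards [h1, h2] with x hx1 hx2
    exact ⟨hx1, fun hv => hx2 _ hx1 hv rfl⟩
  obtain ⟨x0, hx0⟩ := haeT.exists
  have hr : ∀ t : T, ∃ r, rowL U r = t.1 := fun t => nonempty_of_measure_ne_zero t.2.2
  choose r hr using hr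
  let e : T ≃ Fin (Fintype.card T) := Fintype.equivFin T
  let t0 : T := ⟨_, hx0⟩
  let c0 : I01 → T := fun x => if h : rowL U x ∈ T then ⟨_, h⟩ else t0
  have hc0 : ∀ x, rowL U x ∈ T → (c0 x).1 = rowL U x := by
    intro x hx; simp [c0, hx]
  have hfib : ∀ t : T, t ≠ t0 → c0 ⁻¹' {t} = {x | rowL U x = rowL U (r t)} := by
    intro t ht
    ext x
    simp only [Set.mem_preimage, Set.mem_singleton_iff, Set.mem_ofPred_eq]
    rw [hr]
    by_cases hx : rowL U x ∈ T
    · rw [← hc0 x hx]; exact Subtype.ext_iff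
    · simp only [c0, hx, dif_neg, not_false_eq_true]
      constructor
      · intro h; exact absurd h.symm ht
      · intro h; exact absurd (h ▸ t.2) hx
  have hfibm : ∀ t : T, MeasurableSet (c0 ⁻¹' {t}) := by
    have hne : ∀ t : T, t ≠ t0 → MeasurableSet (c0 ⁻¹' {t}) := by
      intro t ht; rw [hfib t ht]; exact row_meas U _
    intro t
    by_cases ht : t = t0
    · have : c0 ⁻¹' {t} = (⋃ s ∈ {s : T | s ≠ t0}, c0 ⁻¹' {s})ᶜ := by
        ext x
        simp only [Set.mem_preimage, Set.mem_singleton_iff, Set.mem_compl_iff, Set.mem_iUnion,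
          exists_prop, not_exists, ht]
        constructor
        · rintro h s ⟨hs, hs'⟩
          exact hs (hs'.symm.trans h)
        · intro h
          by_contra hne'
          exact h (c0 x) ⟨hne', rfl⟩
      rw [this]
      exact (MeasurableSet.biUnion (Set.to_countable _) fun s hs => hne s hs).compl
    · exact hne t ht
  refine ⟨Fintype.card T, hcard, fun x => e (c0 x), fun i => r (e.symm i), ?_, ?_, ?_⟩
  · refine measurable_to_countable' fun i => ?_
    have : (fun x => e (c0 x)) ⁻¹' {i} = c0 ⁻¹' {e.symm i} := by
      ext x; simp [Equiv.eq_symm_apply]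
    rw [this]; exact hfibm _
  · intro i h
    refine (e.symm i).2.2 (measure_mono_null ?_ h)
    intro x hx
    have hx' : rowL U x = (e.symm i).1 := hx
    have : c0 x = e.symm i := Subtype.ext (by
      rw [hc0 x (hx' ▸ (e.symm i).2), hx'])
    simp [this]
  · filter_upwards [haeT] with x hx
    simp [hr, hc0 x hx]

theorem forward (q : ℕ) (U : GKernel) (h0 : QI (q + 1) U = 0) :
    ∃ V : GKernel, WeaklyIsomorphic U V ∧ ∃ q' : ℕ, q' ≤ q ∧ HasStepPartition V q' := by
  obtain ⟨q', hq', c, r, hc, hpos, hr⟩ := exists_classes q U h0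
  have hrc : Measurable (fun x => r (c x)) := (Measurable.of_discrete (f := r)).comp hc
  have h1 : ∀ᵐ y : I01, ∀ᵐ x : I01, U.toFun y x = U.toFun (r (c y)) x := by
    filter_upwards [hr] with y hy
    exact (row_eq_iff U _ _).1 hy
  have h2 : ∀ᵐ x : I01, ∀ᵐ y : I01, U.toFun y x = U.toFun (r (c y)) x := by
    rw [← Measure.ae_ae_comm] 
    · exact h1
    · exact measurableSet_eq_fun (U.meas_comp measurable_fst measurable_snd)
        (U.meas_comp (hrc.comp measurable_fst) measurable_snd)
  have h3 : ∀ i, ∃ x, c x = i ∧ rowL U x = rowL U (r i) ∧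
      ∀ᵐ y : I01, U.toFun y x = U.toFun (r (c y)) x := by
    intro i
    by_contra hne
    apply hpos i
    have hae := hr.and h2
    refine measure_mono_null ?_ (ae_iff.1 hae)
    intro x hx
    have hx' : c x = i := hx
    rintro ⟨ha, hb⟩
    rw [hx'] at ha
    exact hne ⟨x, hx', ha, hb⟩
  choose z hz1 hz2 hz3 using h3
  let W : Fin q' → Fin q' → ℝ := fun i j => U.toFun (r j) (z i)
  have h4 : ∀ᵐ x : I01, ∀ᵐ y : I01, U.toFun x y = W (c x) (c y) := by
    filter_upwards [hr] with x hx
    rw [← hz2, row_eq_iff] at hx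
    filter_upwards [hx, hz3 (c x)] with y hy1 hy2
    rw [hy1, U.symm', hy2]
  have hW : Measurable (fun p : I01 × I01 => W (c p.1) (c p.2)) :=
    (Measurable.of_discrete (f := fun p : Fin q' × Fin q' => W p.1 p.2)).comp
      ((hc.comp measurable_fst).prodMk (hc.comp measurable_snd))
  have hW' : Measurable (fun p : I01 × I01 => W (c p.2) (c p.1)) := hW.comp measurable_swap
  have h5 : ∀ᵐ y : I01, ∀ᵐ x : I01, U.toFun x y = W (c x) (c y) := by
    rw [← Measure.ae_ae_comm]
    · exact h4
    · exact measurableSet_eq_fun (U.meas_comp measurable_fst measurable_snd) hW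
  let V : GKernel :=
    { toFun := fun x y => (W (c x) (c y) + W (c y) (c x)) / 2
      measurable' := (hW.add hW').div_const 2
      bounded' := by
        obtain ⟨C, hC⟩ := U.bounded'
        refine ⟨C, fun x y => ?_⟩
        have a1 := abs_le.1 (hC (r (c y)) (z (c x)))
        have a2 := abs_le.1 (hC (r (c x)) (z (c y)))
        simp only [W]
        rw [abs_le]
        constructor <;> linarith [a1.1, a1.2, a2.1, a2.2]
      symm' := fun x y => by rw [add_comm] }
  refine ⟨V, weak_of_ae ?_, q', hq', fun i => c ⁻¹' {i}, ?_, ?_, ?_, ?_, ?_⟩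
  · rw [Measure.volume_eq_prod, Measure.ae_prod_iff_ae_ae]
    · filter_upwards [h4, h5] with x hx hx'
      filter_upwards [hx, hx'] with y hy hy'
      simp only [V]
      rw [← hy, ← hy', U.symm' y x]
      ring
    · exact measurableSet_eq_fun (U.meas_comp measurable_fst measurable_snd)
        (V.meas_comp measurable_fst measurable_snd)
  · exact fun i => hc (measurableSet_singleton i)
  · exact fun i => pos_iff_ne_zero.2 (hpos i)
  · intro i j hij
    exact Disjoint.preimage c (Set.disjoint_singleton.2 hij)
  · ext x; simp
  · intro i j
    refine ⟨(W i j + W j i) / 2, ?_⟩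
    rintro x hx y hy
    have hx' : c x = i := hx
    have hy' : c y = j := hy
    simp only [V, hx', hy']

theorem statement3 (q : ℕ) (hq : 1 ≤ q) (U : GKernel) :
    (∫ x : (Fin (q + 1) → I01) × (Fin (q + 1) → I01),
        ∏ i : Fin (q + 1), ∏ j ∈ Finset.Ioi i,
          (∫ y : I01, (U.toFun (x.1 i) y - U.toFun (x.1 j) y) *
            (U.toFun (x.2 i) y - U.toFun (x.2 j) y)) ^ 2) = 0 ↔
      ∃ V : GKernel, WeaklyIsomorphic U V ∧
        ∃ q' : ℕ, q' ≤ q ∧ HasStepPartition V q' := by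
  constructor
  · exact forward q U
  · rintro ⟨V, hV, q', hq', hs⟩
    exact (QI_congr (q + 1) hV).trans (QI_step q q' hq' V hs)

end
end

section
/- For every even integer q ≥ 2 and all integers s₁,…,s_q with q+2 ≤ s_i ≤ 2q+2 for each i∈[q], there exists a finite simple graph G whose vertex set is the disjoint union of sets V₁,…,V_q satisfying: (i) |V_i| = s_i for each i∈[q]; (ii) the edge set of G can be partitioned into four sets M₁, M₂, M₃, M₄ such that for every 1 ≤ i < j ≤ q, the set of edges of M₁ with both endpoints in V_i ∪ V_j is a matching of size q+2, likewise for M₂, while for M₃ and for M₄ the corresponding restriction is a matching of size q; (iii) the chromatic number of G equals q, and in every proper q-coloring of G the color classes are exactly the sets V₁,…,V_q (in particular each V_i is an independent set). -/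
open MeasureTheory
open scoped BigOperators Classical

noncomputable section

theorem matching_aux {V : Type} {c : ℕ} (p r : Fin c → V) (hp : Function.Injective p)
    (hr : Function.Injective r) (hpr : ∀ t t', p t ≠ r t') (S : Set (Sym2 V))
    (hS : ∀ e, e ∈ S ↔ ∃ t, s(p t, r t) = e) :
    IsMatchingSet S ∧ S.ncard = c := by
  have hinj : Function.Injective (fun t => s(p t, r t)) := by
    intro t t' h
    simp only [Sym2.eq_iff] at h
    rcases h with h | h
    · exact hp h.1
    · exact absurd h.1 (hpr _ _)
  have hS' : S = Set.range (fun t => s(p t, r t)) := by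
    ext e; rw [hS]; rfl
  refine ⟨⟨?_, ?_⟩, ?_⟩
  · intro e he
    obtain ⟨t, rfl⟩ := (hS e).1 he
    simpa using hpr t t
  · intro e he f hf hef v hv
    obtain ⟨t, rfl⟩ := (hS e).1 he
    obtain ⟨t', rfl⟩ := (hS f).1 hf
    apply hef
    have : t = t' := by
      obtain ⟨h1, h2⟩ := hv
      rw [Sym2.mem_iff] at h1 h2
      rcases h1 with h1 | h1 <;> rcases h2 with h2 | h2
      · exact hp (h1.symm.trans h2)
      · exact absurd (h1.symm.trans h2) (hpr _ _)
      · exact absurd (h2.symm.trans h1) (hpr _ _)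
      · exact hr (h1.symm.trans h2)
    rw [this]
  · rw [hS', ← Set.image_univ, Set.ncard_image_of_injective _ hinj, Set.ncard_univ]
    simp

/-- Index relation between position `a` in `V_i` (size `m`) and `b` in `V_j` (size `n`), `i < j`. -/
def RR (q : ℕ) (k : Fin 4) (m n a b : ℕ) : Prop :=
  (k = 0 ∧ a = b ∧ b < q + 2) ∨
  (k = 1 ∧ ((a = b + 1 ∧ b < q + 1) ∨ (a = 0 ∧ b + 1 = n))) ∨
  (k = 2 ∧ a < q ∧ b + q = a + n) ∨
  (k = 3 ∧ b < q ∧ a + q = b + m)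

def MM (q : ℕ) (s : Fin q → ℕ) (k : Fin 4) : Set (Sym2 ((l : Fin q) × Fin (s l))) :=
  {e | ∃ (i j : Fin q) (a : Fin (s i)) (b : Fin (s j)), i < j ∧
    RR q k (s i) (s j) a b ∧ s(⟨i, a⟩, ⟨j, b⟩) = e}

theorem mem_edgesIn (q : ℕ) (s : Fin q → ℕ) (k : Fin 4) (i j : Fin q) (hij : i < j)
    (e : Sym2 ((l : Fin q) × Fin (s l))) :
    e ∈ EdgesIn (MM q s k) i j ↔ ∃ (a : Fin (s i)) (b : Fin (s j)),
      RR q k (s i) (s j) a b ∧ s(⟨i, a⟩, ⟨j, b⟩) = e := by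
  constructor
  · rintro ⟨⟨i', j', a, b, hlt, hR, rfl⟩, h⟩
    have h1 := h ⟨i', a⟩ (by simp)
    have h2 := h ⟨j', b⟩ (by simp)
    simp only at h1 h2
    have h3 : i' = i ∧ j' = j := by
      rcases h1 with h1 | h1 <;> rcases h2 with h2 | h2 <;> subst h1 <;> subst h2
      · exact absurd hlt (lt_irrefl _)
      · exact ⟨rfl, rfl⟩
      · exact absurd hlt (lt_asymm hij)
      · exact absurd hlt (lt_irrefl _)
    obtain ⟨rfl, rfl⟩ := h3
    exact ⟨a, b, hR, rfl⟩
  · rintro ⟨a, b, hR, rfl⟩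
    refine ⟨⟨i, j, a, b, hij, hR, rfl⟩, ?_⟩
    intro v hv
    rw [Sym2.mem_iff] at hv
    rcases hv with rfl | rfl
    · exact Or.inl rfl
    · exact Or.inr rfl

theorem matching_MM (q : ℕ) (s : Fin q → ℕ) (k : Fin 4) (i j : Fin q) (hij : i < j) (c : ℕ)
    (p r : ℕ → ℕ) (hp : ∀ t < c, p t < s i) (hr : ∀ t < c, r t < s j)
    (hpi : ∀ t < c, ∀ t' < c, p t = p t' → t = t')
    (hri : ∀ t < c, ∀ t' < c, r t = r t' → t = t')
    (hR : ∀ a b, a < s i → b < s j → (RR q k (s i) (s j) a b ↔ ∃ t < c, p t = a ∧ r t = b)) :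
    IsMatchingSet (EdgesIn (MM q s k) i j) ∧ (EdgesIn (MM q s k) i j).ncard = c := by
  apply matching_aux (fun t : Fin c => (⟨i, ⟨p t, hp t t.2⟩⟩ : (l : Fin q) × Fin (s l)))
    (fun t : Fin c => (⟨j, ⟨r t, hr t t.2⟩⟩ : (l : Fin q) × Fin (s l)))
  · intro t t' h
    simp only [Sigma.mk.injEq, heq_eq_eq, true_and, Fin.mk.injEq] at h
    exact Fin.ext (hpi _ t.2 _ t'.2 h)
  · intro t t' h
    simp only [Sigma.mk.injEq, heq_eq_eq, true_and, Fin.mk.injEq] at h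
    exact Fin.ext (hri _ t.2 _ t'.2 h)
  · intro t t' h
    exact hij.ne (congrArg Sigma.fst h)
  · intro e
    rw [mem_edgesIn q s k i j hij]
    constructor
    · rintro ⟨a, b, h, rfl⟩
      obtain ⟨t, ht, h1, h2⟩ := (hR a b a.2 b.2).1 h
      exact ⟨⟨t, ht⟩, by simp only [h1, h2]⟩
    · rintro ⟨t, rfl⟩
      exact ⟨_, _, (hR _ _ (hp t t.2) (hr t t.2)).2 ⟨t, t.2, rfl, rfl⟩, rfl⟩

theorem RR_disj (q : ℕ) (hq : 2 ≤ q) (k l : Fin 4) (m n a b : ℕ) (hm : q + 2 ≤ m)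
    (hn : q + 2 ≤ n) (hk : RR q k m n a b) (hl : RR q l m n a b) : k = l := by
  rcases hk with ⟨rfl, h⟩ | ⟨rfl, h⟩ | ⟨rfl, h⟩ | ⟨rfl, h⟩ <;>
  rcases hl with ⟨rfl, h'⟩ | ⟨rfl, h'⟩ | ⟨rfl, h'⟩ | ⟨rfl, h'⟩ <;>
  first | rfl | (exfalso; omega)

theorem MM_adj_ne {q : ℕ} {s : Fin q → ℕ} {k : Fin 4} {u v : (l : Fin q) × Fin (s l)}
    (h : s(u, v) ∈ MM q s k) : u.1 ≠ v.1 := by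
  obtain ⟨i, j, a, b, hij, -, he⟩ := h
  rcases Sym2.eq_iff.1 he with ⟨rfl, rfl⟩ | ⟨rfl, rfl⟩
  · exact hij.ne
  · exact hij.ne'

def GG (q : ℕ) (s : Fin q → ℕ) : SimpleGraph ((l : Fin q) × Fin (s l)) :=
  SimpleGraph.fromEdgeSet (⋃ k, MM q s k)

theorem GG_adj_ne {q : ℕ} {s : Fin q → ℕ} {u v : (l : Fin q) × Fin (s l)}
    (h : (GG q s).Adj u v) : u.1 ≠ v.1 := by
  rw [GG, SimpleGraph.fromEdgeSet_adj] at h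
  obtain ⟨k, hk⟩ := Set.mem_iUnion.1 h.1
  exact MM_adj_ne hk

theorem GG_adj {q : ℕ} {s : Fin q → ℕ} (k : Fin 4) {i j : Fin q} (hij : i < j)
    (a : Fin (s i)) (b : Fin (s j)) (h : RR q k (s i) (s j) a b) :
    (GG q s).Adj ⟨i, a⟩ ⟨j, b⟩ := by
  rw [GG, SimpleGraph.fromEdgeSet_adj]
  refine ⟨Set.mem_iUnion.2 ⟨k, i, j, a, b, hij, h, rfl⟩, ?_⟩
  intro h
  exact hij.ne (congrArg Sigma.fst h)

/-- Every non-base vertex has an earlier neighbour in every other class. -/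
theorem GG_back {q : ℕ} {s : Fin q → ℕ} (hs : ∀ i, q + 2 ≤ s i ∧ s i ≤ 2 * q + 2)
    (i l : Fin q) (hil : i ≠ l) (a : Fin (s i)) (ha : 0 < a.1) :
    ∃ b : Fin (s l), (b.1 < a.1 ∨ (b.1 = a.1 ∧ l < i)) ∧ (GG q s).Adj ⟨i, a⟩ ⟨l, b⟩ := by
  have hi := hs i
  have hl := hs l
  have ha2 := a.2
  rcases lt_or_gt_of_ne hil with h | h
  · by_cases h1 : a.1 < q + 2
    · refine ⟨⟨a.1 - 1, by omega⟩, Or.inl (by simp only; omega), GG_adj 1 h _ _ ?_⟩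
      exact Or.inr (Or.inl ⟨rfl, Or.inl (by simp only; omega)⟩)
    · refine ⟨⟨a.1 + q - s i, by omega⟩, Or.inl (by simp only; omega), GG_adj 3 h _ _ ?_⟩
      exact Or.inr (Or.inr (Or.inr ⟨rfl, by simp only; omega⟩))
  · by_cases h1 : a.1 < q + 2
    · refine ⟨⟨a.1, by omega⟩, Or.inr ⟨rfl, h⟩, (GG_adj 0 h _ _ ?_).symm⟩
      exact Or.inl ⟨rfl, rfl, h1⟩
    · refine ⟨⟨a.1 + q - s i, by omega⟩, Or.inl (by simp only; omega), (GG_adj 2 h _ _ ?_).symm⟩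
      exact Or.inr (Or.inr (Or.inl ⟨rfl, by simp only; omega⟩))

theorem GG_base {q : ℕ} {s : Fin q → ℕ} (hs : ∀ i, 0 < s i)
    (i l : Fin q) (hil : i ≠ l) : (GG q s).Adj ⟨i, ⟨0, hs i⟩⟩ ⟨l, ⟨0, hs l⟩⟩ := by
  rcases lt_or_gt_of_ne hil with h | h
  · exact GG_adj 0 h _ _ (Or.inl ⟨rfl, rfl, by simp⟩)
  · exact (GG_adj 0 h _ _ (Or.inl ⟨rfl, rfl, by simp⟩)).symm

theorem GG_unique {q : ℕ} {s : Fin q → ℕ} (hs : ∀ i, q + 2 ≤ s i ∧ s i ≤ 2 * q + 2)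
    (C : (GG q s).Coloring (Fin q)) (u v : (l : Fin q) × Fin (s l)) :
    C u = C v ↔ u.1 = v.1 := by
  have h0 : ∀ i, 0 < s i := fun i => by have := hs i; omega
  let f : Fin q → Fin q := fun i => C ⟨i, ⟨0, h0 i⟩⟩
  have hf : Function.Injective f := by
    intro i l h
    by_contra hne
    exact C.valid (GG_base h0 i l hne) h
  have hsurj : Function.Surjective f := Finite.surjective_of_injective hf
  have key : ∀ n : ℕ, ∀ m : ℕ, ∀ i : Fin q, i.1 = m → ∀ a : Fin (s i), a.1 = n →
      C ⟨i, a⟩ = f i := by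
    intro n
    induction n using Nat.strong_induction_on with
    | _ n ihn =>
      intro m
      induction m using Nat.strong_induction_on with
      | _ m ihm =>
        intro i hi a ha
        by_cases hz : a.1 = 0
        · have : a = ⟨0, h0 i⟩ := Fin.ext hz
          rw [this]
        · obtain ⟨l, hl⟩ := hsurj (C ⟨i, a⟩)
          by_cases hil : i = l
          · rw [← hl, hil]
          · exfalso
            obtain ⟨b, hb, hadj⟩ := GG_back hs i l hil a (by omega)
            have hcb : C ⟨l, b⟩ = f l := by
              rcases hb with hb | ⟨hb, hli⟩
              · exact ihn b.1 (by omega) l.1 l rfl b rfl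
              · exact ihm l.1 (by rw [← hi]; exact hli) l rfl b (by omega)
            exact C.valid hadj (by rw [hcb, hl])
  obtain ⟨i, a⟩ := u
  obtain ⟨j, b⟩ := v
  rw [key _ _ i rfl a rfl, key _ _ j rfl b rfl]
  exact hf.eq_iff

theorem GG_chrom {q : ℕ} {s : Fin q → ℕ} (hs : ∀ i, 0 < s i) :
    (GG q s).chromaticNumber = (q : ℕ∞) := by
  apply le_antisymm
  · apply SimpleGraph.Colorable.chromaticNumber_le
    exact ⟨SimpleGraph.Coloring.mk (fun u => u.1) (fun h => GG_adj_ne h)⟩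
  · refine le_iInf₂ ?_
    intro n hn
    obtain ⟨C⟩ := hn
    have : Function.Injective (fun i : Fin q => C ⟨i, ⟨0, hs i⟩⟩) := by
      intro i l h
      by_contra hne
      exact C.valid (GG_base hs i l hne) h
    have h2 := Fintype.card_le_of_injective _ this
    simpa using h2

theorem statement4 (q : ℕ) (hq : 2 ≤ q) (hqe : Even q) (s : Fin q → ℕ)
    (hs : ∀ i, q + 2 ≤ s i ∧ s i ≤ 2 * q + 2) :
    ∃ G : SimpleGraph ((l : Fin q) × Fin (s l)),
      (∃ M : Fin 4 → Set (Sym2 ((l : Fin q) × Fin (s l))),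
        Pairwise (fun k l => Disjoint (M k) (M l)) ∧
        (⋃ k, M k) = G.edgeSet ∧
        ∀ i j : Fin q, i < j →
          (IsMatchingSet (EdgesIn (M 0) i j) ∧ (EdgesIn (M 0) i j).ncard = q + 2) ∧
          (IsMatchingSet (EdgesIn (M 1) i j) ∧ (EdgesIn (M 1) i j).ncard = q + 2) ∧
          (IsMatchingSet (EdgesIn (M 2) i j) ∧ (EdgesIn (M 2) i j).ncard = q) ∧
          (IsMatchingSet (EdgesIn (M 3) i j) ∧ (EdgesIn (M 3) i j).ncard = q)) ∧
      G.chromaticNumber = (q : ℕ∞) ∧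
      (∀ C : G.Coloring (Fin q), ∀ u v, C u = C v ↔ u.1 = v.1) := by
  have h0 : ∀ i, 0 < s i := fun i => by have := hs i; omega
  refine ⟨GG q s, ⟨MM q s, ?_, ?_, ?_⟩, GG_chrom h0, fun C u v => GG_unique hs C u v⟩
  · intro k l hkl
    rw [Set.disjoint_left]
    rintro e ⟨i, j, a, b, hij, hR, rfl⟩ ⟨i', j', a', b', hij', hR', he⟩
    apply hkl
    rcases Sym2.eq_iff.1 he with ⟨h1, h2⟩ | ⟨h1, h2⟩
    · cases h1
      cases h2
      exact RR_disj q hq k l _ _ _ _ (hs _).1 (hs _).1 hR hR'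
    · have h1' := congrArg Sigma.fst h1
      have h2' := congrArg Sigma.fst h2
      simp only at h1' h2'
      subst h1' h2'
      exact absurd hij (lt_asymm hij')
  · rw [GG, SimpleGraph.edgeSet_fromEdgeSet]
    symm
    rw [sdiff_eq_left, Set.disjoint_left]
    intro e he
    obtain ⟨k, hk⟩ := Set.mem_iUnion.1 he
    obtain ⟨i, j, a, b, hij, hR, rfl⟩ := hk
    intro hd
    have hd' : (⟨i, a⟩ : (l : Fin q) × Fin (s l)) = ⟨j, b⟩ := by simpa using hd
    exact hij.ne (congrArg Sigma.fst hd')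
  · intro i j hij
    have hi := hs i
    have hj := hs j
    refine ⟨?_, ?_, ?_, ?_⟩
    · apply matching_MM q s 0 i j hij (q + 2) (fun t => t) (fun t => t)
      · intro t ht; omega
      · intro t ht; omega
      · intro t ht t' ht' h; exact h
      · intro t ht t' ht' h; exact h
      · intro a b ha hb
        simp only [RR]
        constructor
        · rintro (⟨-, h⟩ | ⟨h, -⟩ | ⟨h, -⟩ | ⟨h, -⟩)
          · exact ⟨a, by omega⟩
          all_goals exact absurd h (by decide)
        · rintro ⟨t, h⟩
          exact Or.inl ⟨by trivial, by omega⟩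
    · apply matching_MM q s 1 i j hij (q + 2) (fun t => if t < q + 1 then t + 1 else 0)
        (fun t => if t < q + 1 then t else s j - 1)
      · intro t ht; split_ifs <;> omega
      · intro t ht; split_ifs <;> omega
      · intro t ht t' ht' h; split_ifs at h <;> omega
      · intro t ht t' ht' h; split_ifs at h <;> omega
      · intro a b ha hb
        simp only [RR]
        constructor
        · rintro (⟨h, -⟩ | ⟨-, h⟩ | ⟨h, -⟩ | ⟨h, -⟩)
          · exact absurd h (by decide)
          · rcases h with h | h
            · exact ⟨b, by omega, by rw [if_pos h.2]; omega, by rw [if_pos h.2]⟩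
            · exact ⟨q + 1, by omega, by rw [if_neg (by omega)]; omega,
                by rw [if_neg (by omega)]; omega⟩
          all_goals exact absurd h (by decide)
        · rintro ⟨t, h1, h2, h3⟩
          refine Or.inr (Or.inl ⟨by trivial, ?_⟩)
          split_ifs at h2 h3 <;> omega
    · apply matching_MM q s 2 i j hij q (fun t => t) (fun t => t + s j - q)
      · intro t ht; omega
      · intro t ht; omega
      · intro t ht t' ht' h; exact h
      · intro t ht t' ht' h; omega
      · intro a b ha hb
        simp only [RR]
        constructor
        · rintro (⟨h, -⟩ | ⟨h, -⟩ | ⟨-, h⟩ | ⟨h, -⟩)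
          · exact absurd h (by decide)
          · exact absurd h (by decide)
          · exact ⟨a, by omega⟩
          · exact absurd h (by decide)
        · rintro ⟨t, h⟩
          exact Or.inr (Or.inr (Or.inl ⟨by trivial, by omega⟩))
    · apply matching_MM q s 3 i j hij q (fun t => t + s i - q) (fun t => t)
      · intro t ht; omega
      · intro t ht; omega
      · intro t ht t' ht' h; omega
      · intro t ht t' ht' h; exact h
      · intro a b ha hb
        simp only [RR]
        constructor
        · rintro (⟨h, -⟩ | ⟨h, -⟩ | ⟨h, -⟩ | ⟨-, h⟩)
          · exact absurd h (by decide)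
          · exact absurd h (by decide)
          · exact absurd h (by decide)
          · exact ⟨b, by omega⟩
        · rintro ⟨t, h⟩
          exact Or.inr (Or.inr (Or.inr ⟨by trivial, by omega⟩))

end
end

section
/- For every odd integer q ≥ 3 and all integers s₁,…,s_q with q+2 ≤ s_i ≤ 2q+2 for each i∈[q], there exists a finite simple graph G whose vertex set is the disjoint union of sets V₁,…,V_q satisfying: (i) |V_i| = s_i for each i∈[q]; (ii) the edge set of G can be partitioned into four sets M₁, M₂, M₃, M₄ such that for every 1 ≤ i < j ≤ q and every k∈{1,2,3,4}, the set of edges of M_k with both endpoints in V_i ∪ V_j is a matching of size q+1; (iii) the chromatic number of G equals q, and in every proper q-coloring of G the color classes are exactly the sets V₁,…,V_q (in particular each V_i is an independent set). -/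
open MeasureTheory
open scoped BigOperators Classical

noncomputable section

def s5Y (k : Fin 4) (t : ℕ) : ℕ := 2 * t + k.val / 2

def s5X (n : ℕ) (k : Fin 4) (t : ℕ) : ℕ :=
  if k.val % 2 = 0 then s5Y k t else if s5Y k t + 1 = 2 * n then 0 else s5Y k t + 1

def s5F (n a x : ℕ) : ℕ := if x < a then x else x - (n - 1)

def s5H (n b y : ℕ) : ℕ := if y < b then y else y - (n + 1)

theorem s5F_inj {n a : ℕ} (h4 : 4 ≤ n) (he : n % 2 = 0) (h1 : n + 1 ≤ a) (h2 : a ≤ 2 * n)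
    (k : Fin 4) {t t' : ℕ} (ht : t < n) (ht' : t' < n)
    (h : s5F n a (s5X n k t) = s5F n a (s5X n k t')) : t = t' := by
  have hk := k.isLt
  have key : s5X n k t < 2 * n ∧ s5X n k t' < 2 * n ∧ s5X n k t % 2 = s5X n k t' % 2 ∧
      (s5X n k t = s5X n k t' → t = t') := by
    unfold s5X s5Y
    obtain hd | hd : k.val / 2 = 0 ∨ k.val / 2 = 1 := by omega
    all_goals
      rw [hd]
      split_ifs <;> refine ⟨?_, ?_, ?_, fun h => ?_⟩ <;> first | omega | exact h.elim
  obtain ⟨k1, k2, k3, k4⟩ := key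
  apply k4
  unfold s5F at h
  split_ifs at h <;> omega

theorem s5H_inj {n a : ℕ} (h4 : 4 ≤ n) (he : n % 2 = 0) (h1 : n + 1 ≤ a) (h2 : a ≤ 2 * n)
    (k : Fin 4) {t t' : ℕ} (ht : t < n) (ht' : t' < n)
    (h : s5H n a (s5Y k t) = s5H n a (s5Y k t')) : t = t' := by
  fin_cases k <;> simp [s5H, s5Y] at h <;> split_ifs at h <;> omega

theorem s5_aux {n a b : ℕ} (h4 : 4 ≤ n) (he : n % 2 = 0) (h1 : n + 1 ≤ a) (h2 : a ≤ 2 * n)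
    (h3 : n + 1 ≤ b) (h5 : b ≤ 2 * n) {x y x' y' : ℕ}
    (hx : x < 2 * n) (hy : y < 2 * n) (hx' : x' < 2 * n) (hy' : y' < 2 * n)
    (e : x = y ∨ x = y + 1 ∨ (x = 0 ∧ y + 1 = 2 * n))
    (e' : x' = y' ∨ x' = y' + 1 ∨ (x' = 0 ∧ y' + 1 = 2 * n))
    (hF : s5F n a x = s5F n a x') (hH : s5H n b y = s5H n b y') : x = x' ∧ y = y' := by
  unfold s5F at hF
  unfold s5H at hH
  split_ifs at hF hH <;> omega

theorem s5X_spec {n : ℕ} (h4 : 4 ≤ n) (k : Fin 4) {t : ℕ} (ht : t < n) :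
    s5X n k t < 2 * n ∧ s5Y k t < 2 * n ∧
    (s5X n k t = s5Y k t ∨ s5X n k t = s5Y k t + 1 ∨ (s5X n k t = 0 ∧ s5Y k t + 1 = 2 * n)) := by
  have := k.isLt
  unfold s5X s5Y
  split_ifs <;> omega

theorem s5_k {n : ℕ} (h4 : 4 ≤ n) {k k' : Fin 4} {t t' : ℕ}
    (hX : s5X n k t = s5X n k' t') (hY : s5Y k t = s5Y k' t') : k = k' := by
  have := k.isLt
  have := k'.isLt
  apply Fin.ext
  unfold s5X at hX
  rw [hY] at hX
  unfold s5Y at hX hY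
  split_ifs at hX <;> omega

def s5M {q : ℕ} (s : Fin q → ℕ) (k : Fin 4) : Set (Sym2 ((l : Fin q) × Fin (s l))) :=
  {e | ∃ u v : (l : Fin q) × Fin (s l), e = s(u, v) ∧ u.1 < v.1 ∧ ∃ t < q + 1,
    u.2.val = s5F (q + 1) (s u.1) (s5X (q + 1) k t) ∧ v.2.val = s5H (q + 1) (s v.1) (s5Y k t)}

theorem s5_edge {q : ℕ} {s : Fin q → ℕ} {u v u' v' : (l : Fin q) × Fin (s l)}
    (h : s(u, v) = s(u', v')) (h1 : u.1 < v.1) (h2 : u'.1 < v'.1) : u = u' ∧ v = v' := by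
  rcases Sym2.eq_iff.1 h with h | ⟨rfl, rfl⟩
  · exact h
  · exact absurd h1 (not_lt.2 h2.le)

theorem s5_disj {q : ℕ} (hq : 3 ≤ q) (hqo : Odd q) {s : Fin q → ℕ}
    (hs : ∀ i, q + 2 ≤ s i ∧ s i ≤ 2 * q + 2) :
    Pairwise (fun k l => Disjoint (s5M s k) (s5M s l)) := by
  intro k l hkl
  rw [Set.disjoint_left]
  rintro e ⟨u, v, rfl, h, t, ht, hu, hv⟩ ⟨u', v', h0, h', t', ht', hu', hv'⟩
  obtain ⟨rfl, rfl⟩ := s5_edge h0 h h'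
  have a1 := hs u.1
  have a2 := hs v.1
  obtain ⟨m, hm⟩ := hqo
  obtain ⟨p1, p2, p3⟩ := s5X_spec (n := q + 1) (by omega) k ht
  obtain ⟨p4, p5, p6⟩ := s5X_spec (n := q + 1) (by omega) l ht'
  obtain ⟨h1, h2⟩ := s5_aux (n := q + 1) (a := s u.1) (b := s v.1) (by omega) (by omega) (by omega)
    (by omega) (by omega) (by omega) p1 p2 p4 p5 p3 p6 (hu ▸ hu') (hv ▸ hv')
  exact hkl (s5_k (n := q + 1) (by omega) h1 h2)

theorem s5_in {q : ℕ} {s : Fin q → ℕ} {i j : Fin q} (hij : i < j) {k : Fin 4}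
    {e : Sym2 ((l : Fin q) × Fin (s l))} (he : e ∈ EdgesIn (s5M s k) i j) :
    ∃ (u : Fin (s i)) (v : Fin (s j)), e = s(⟨i, u⟩, ⟨j, v⟩) ∧ ∃ t < q + 1,
      u.val = s5F (q + 1) (s i) (s5X (q + 1) k t) ∧ v.val = s5H (q + 1) (s j) (s5Y k t) := by
  obtain ⟨⟨⟨a, u⟩, ⟨b, v⟩, rfl, h, t, ht, hu, hv⟩, hin⟩ := he
  have h1 := hin ⟨a, u⟩ (by simp)
  have h2 := hin ⟨b, v⟩ (by simp)
  dsimp only at h h1 h2 hu hv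
  obtain ⟨rfl, rfl⟩ : a = i ∧ b = j := by
    rcases h1 with rfl | rfl <;> rcases h2 with rfl | rfl
    · exact absurd h (lt_irrefl _)
    · exact ⟨rfl, rfl⟩
    · exact absurd h (not_lt.2 hij.le)
    · exact absurd h (lt_irrefl _)
  exact ⟨u, v, rfl, t, ht, hu, hv⟩

theorem s5_match {q : ℕ} (hq : 3 ≤ q) (hqo : Odd q) {s : Fin q → ℕ}
    (hs : ∀ i, q + 2 ≤ s i ∧ s i ≤ 2 * q + 2) {i j : Fin q} (hij : i < j) (k : Fin 4) :
    IsMatchingSet (EdgesIn (s5M s k) i j) := by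
  obtain ⟨m, hm⟩ := hqo
  have a1 := hs i
  have a2 := hs j
  constructor
  · intro e he
    obtain ⟨u, v, rfl, -⟩ := s5_in hij he
    intro h
    rw [Sym2.mk_isDiag_iff] at h
    exact hij.ne (congrArg Sigma.fst h)
  · intro e he f hf hne w ⟨hw1, hw2⟩
    obtain ⟨u, v, rfl, t, ht, hu, hv⟩ := s5_in hij he
    obtain ⟨u', v', rfl, t', ht', hu', hv'⟩ := s5_in hij hf
    apply hne
    have key : t = t' := by
      rw [Sym2.mem_iff] at hw1 hw2
      rcases hw1 with rfl | rfl <;> rcases hw2 with h | h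
      · have : u = u' := by simpa using h
        subst this
        exact s5F_inj (n := q + 1) (a := s i) (by omega) (by omega) (by omega) (by omega) k ht ht'
          (hu ▸ hu')
      · exact absurd (congrArg Sigma.fst h) hij.ne
      · exact absurd (congrArg Sigma.fst h) hij.ne'
      · have : v = v' := by simpa using h
        subst this
        exact s5H_inj (n := q + 1) (a := s j) (by omega) (by omega) (by omega) (by omega) k ht ht'
          (hv ▸ hv')
    subst key
    have e1 : u = u' := Fin.ext (hu.trans hu'.symm)
    have e2 : v = v' := Fin.ext (hv.trans hv'.symm)
    rw [e1, e2]

theorem s5F_lt {n a x : ℕ} (h4 : 4 ≤ n) (h1 : n + 1 ≤ a) (hx : x < 2 * n) : s5F n a x < a := by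
  unfold s5F
  split_ifs <;> omega

theorem s5H_lt {n a x : ℕ} (h4 : 4 ≤ n) (h1 : n + 1 ≤ a) (hx : x < 2 * n) : s5H n a x < a := by
  unfold s5H
  split_ifs <;> omega

theorem s5_card {q : ℕ} (hq : 3 ≤ q) (hqo : Odd q) {s : Fin q → ℕ}
    (hs : ∀ i, q + 2 ≤ s i ∧ s i ≤ 2 * q + 2) {i j : Fin q} (hij : i < j) (k : Fin 4) :
    (EdgesIn (s5M s k) i j).ncard = q + 1 := by
  obtain ⟨m, hm⟩ := hqo
  have a1 := hs i
  have a2 := hs j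
  have b1 : ∀ t : Fin (q + 1), s5F (q + 1) (s i) (s5X (q + 1) k t) < s i := fun t =>
    s5F_lt (by omega) (by omega) (s5X_spec (n := q + 1) (by omega) k t.isLt).1
  have b2 : ∀ t : Fin (q + 1), s5H (q + 1) (s j) (s5Y k t) < s j := fun t =>
    s5H_lt (by omega) (by omega) (s5X_spec (n := q + 1) (by omega) k t.isLt).2.1
  let g : Fin (q + 1) → Sym2 ((l : Fin q) × Fin (s l)) := fun t =>
    s(⟨i, ⟨_, b1 t⟩⟩, ⟨j, ⟨_, b2 t⟩⟩)
  have hg : Function.Injective g := by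
    intro t t' h
    have h1 := (s5_edge h hij hij).1
    have h2 : s5F (q + 1) (s i) (s5X (q + 1) k t) = s5F (q + 1) (s i) (s5X (q + 1) k t') := by
      simpa using h1
    exact Fin.ext (s5F_inj (n := q + 1) (a := s i) (by omega) (by omega) (by omega) (by omega) k
      t.isLt t'.isLt h2)
  have : EdgesIn (s5M s k) i j = Set.range g := by
    ext e
    constructor
    · intro he
      obtain ⟨u, v, rfl, t, ht, hu, hv⟩ := s5_in hij he
      refine ⟨⟨t, ht⟩, ?_⟩
      have e1 : u = ⟨_, b1 ⟨t, ht⟩⟩ := Fin.ext hu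
      have e2 : v = ⟨_, b2 ⟨t, ht⟩⟩ := Fin.ext hv
      rw [e1, e2]
    · rintro ⟨t, rfl⟩
      refine ⟨⟨_, _, rfl, hij, t, t.isLt, rfl, rfl⟩, ?_⟩
      intro v hv
      rcases Sym2.mem_iff.1 hv with rfl | rfl
      · exact Or.inl rfl
      · exact Or.inr rfl
  rw [this, ← Set.image_univ, Set.ncard_image_of_injective _ hg, Set.ncard_univ]
  simp

def s5G {q : ℕ} (s : Fin q → ℕ) : SimpleGraph ((l : Fin q) × Fin (s l)) :=
  SimpleGraph.fromEdgeSet (⋃ k, s5M s k)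

theorem s5G_edgeSet {q : ℕ} (s : Fin q → ℕ) : (⋃ k, s5M s k) = (s5G s).edgeSet := by
  rw [s5G, SimpleGraph.edgeSet_fromEdgeSet]
  symm
  rw [sdiff_eq_left, Set.disjoint_left]
  intro e he hd
  obtain ⟨k, u, v, rfl, h, -⟩ := Set.mem_iUnion.1 he
  have : u = v := by simpa using hd
  exact h.ne (congrArg Sigma.fst this)

theorem s5G_adj_fst {q : ℕ} {s : Fin q → ℕ} {u v : (l : Fin q) × Fin (s l)}
    (h : (s5G s).Adj u v) : u.1 ≠ v.1 := by
  rw [← SimpleGraph.mem_edgeSet, ← s5G_edgeSet] at h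
  obtain ⟨k, u', v', h0, h, -⟩ := Set.mem_iUnion.1 h
  rcases Sym2.eq_iff.1 h0 with ⟨rfl, rfl⟩ | ⟨rfl, rfl⟩
  · exact h.ne
  · exact h.ne'

theorem s5G_adj {q : ℕ} {s : Fin q → ℕ} {u v : (l : Fin q) × Fin (s l)} (h : u.1 < v.1)
    (k : Fin 4) (t : ℕ) (ht : t < q + 1)
    (hu : u.2.val = s5F (q + 1) (s u.1) (s5X (q + 1) k t))
    (hv : v.2.val = s5H (q + 1) (s v.1) (s5Y k t)) : (s5G s).Adj u v := by
  rw [← SimpleGraph.mem_edgeSet, ← s5G_edgeSet]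
  exact Set.mem_iUnion.2 ⟨k, u, v, rfl, h, t, ht, hu, hv⟩

/-- neighbour in an earlier part -/
theorem s5G_back {q : ℕ} (hq : 3 ≤ q) {s : Fin q → ℕ}
    (hs : ∀ i, q + 2 ≤ s i ∧ s i ≤ 2 * q + 2) {i j : Fin q} (hij : i < j) (y : Fin (s j)) :
    ∃ x : Fin (s i), x.val ≤ y.val ∧ (s5G s).Adj ⟨i, x⟩ ⟨j, y⟩ := by
  have a1 := hs i
  have a2 := hs j
  have hy := y.isLt
  have hF : s5F (q + 1) (s i) y.val < s i := s5F_lt (by omega) (by omega) (by omega)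
  refine ⟨⟨_, hF⟩, ?_, ?_⟩
  · simp only [s5F]
    split_ifs <;> omega
  · rcases Nat.mod_two_eq_zero_or_one y.val with h | h
    · refine s5G_adj hij 0 (y.val / 2) (by omega) ?_ ?_
      · have : s5X (q + 1) 0 (y.val / 2) = y.val := by simp [s5X, s5Y]; omega
        simp only [this]
      · have : s5Y 0 (y.val / 2) = y.val := by simp [s5Y]; omega
        simp only [this, s5H, hy, if_true]
    · refine s5G_adj hij 2 (y.val / 2) (by omega) ?_ ?_
      · have : s5X (q + 1) 2 (y.val / 2) = y.val := by simp [s5X, s5Y]; omega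
        simp only [this]
      · have : s5Y 2 (y.val / 2) = y.val := by simp [s5Y]; omega
        simp only [this, s5H, hy, if_true]

/-- neighbour in a later part -/
theorem s5G_fwd {q : ℕ} (hq : 3 ≤ q) {s : Fin q → ℕ}
    (hs : ∀ i, q + 2 ≤ s i ∧ s i ≤ 2 * q + 2) {i j : Fin q} (hij : i < j) (x : Fin (s i))
    (hx0 : 0 < x.val) :
    ∃ y : Fin (s j), y.val < x.val ∧ (s5G s).Adj ⟨i, x⟩ ⟨j, y⟩ := by
  have a1 := hs i
  have a2 := hs j
  have hx := x.isLt
  have hF : s5H (q + 1) (s j) (x.val - 1) < s j := s5H_lt (by omega) (by omega) (by omega)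
  refine ⟨⟨_, hF⟩, ?_, ?_⟩
  · simp only [s5H]
    split_ifs <;> omega
  · rcases Nat.mod_two_eq_zero_or_one (x.val - 1) with h | h
    · have e2 : s5Y 1 ((x.val - 1) / 2) = x.val - 1 := by simp [s5Y]; omega
      have e1 : s5X (q + 1) 1 ((x.val - 1) / 2) = x.val := by
        simp only [s5X, e2]
        rw [if_neg (by decide), if_neg (by omega)]
        omega
      refine s5G_adj hij 1 ((x.val - 1) / 2) (by omega) ?_ ?_
      · simp only [e1, s5F, hx, if_true]
      · simp only [e2]
    · have e2 : s5Y 3 ((x.val - 1) / 2) = x.val - 1 := by simp [s5Y]; omega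
      have e1 : s5X (q + 1) 3 ((x.val - 1) / 2) = x.val := by
        simp only [s5X, e2]
        rw [if_neg (by decide), if_neg (by omega)]
        omega
      refine s5G_adj hij 3 ((x.val - 1) / 2) (by omega) ?_ ?_
      · simp only [e1, s5F, hx, if_true]
      · simp only [e2]

theorem s5_clique {q : ℕ} (hq : 3 ≤ q) {s : Fin q → ℕ}
    (hs : ∀ i, q + 2 ≤ s i ∧ s i ≤ 2 * q + 2) (hp : ∀ i, 0 < s i) {i j : Fin q} (hij : i ≠ j) :
    (s5G s).Adj ⟨i, ⟨0, hp i⟩⟩ ⟨j, ⟨0, hp j⟩⟩ := by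
  have key : ∀ i j : Fin q, i < j → (s5G s).Adj ⟨i, ⟨0, hp i⟩⟩ ⟨j, ⟨0, hp j⟩⟩ := by
    intro i j h
    obtain ⟨x, hx, ha⟩ := s5G_back hq hs h ⟨0, hp j⟩
    have : x = ⟨0, hp i⟩ := Fin.ext (Nat.le_zero.1 hx)
    rwa [this] at ha
  rcases lt_or_gt_of_ne hij with h | h
  · exact key _ _ h
  · exact (key _ _ h).symm

theorem s5_force {q : ℕ} (hq : 3 ≤ q) {s : Fin q → ℕ}
    (hs : ∀ i, q + 2 ≤ s i ∧ s i ≤ 2 * q + 2) (hp : ∀ i, 0 < s i)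
    (C : (s5G s).Coloring (Fin q)) :
    Function.Injective (fun i => C ⟨i, ⟨0, hp i⟩⟩) ∧
    ∀ (m : ℕ) (i : Fin q) (hm : m < s i), C ⟨i, ⟨m, hm⟩⟩ = C ⟨i, ⟨0, hp i⟩⟩ := by
  have hinj : Function.Injective (fun i => C ⟨i, ⟨0, hp i⟩⟩) := by
    intro i j h
    by_contra hne
    exact C.valid (s5_clique hq hs hp hne) h
  refine ⟨hinj, ?_⟩
  have hsurj := Finite.surjective_of_injective hinj
  intro m
  induction m using Nat.strong_induction_on with
  | _ m ih =>
    intro i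
    induction i using WellFoundedLT.induction with
    | _ i ih2 =>
      intro hm
      rcases Nat.eq_zero_or_pos m with rfl | hpos
      · rfl
      obtain ⟨k, hk⟩ := hsurj (C ⟨i, ⟨m, hm⟩⟩)
      dsimp only at hk
      rcases lt_trichotomy k i with h | rfl | h
      · exfalso
        obtain ⟨x, hx, ha⟩ := s5G_back hq hs h ⟨m, hm⟩
        apply C.valid ha
        rw [← hk]
        rcases lt_or_eq_of_le hx with hx | hx
        · exact ih x.val hx k x.isLt
        · have : ∀ h', C ⟨k, ⟨m, h'⟩⟩ = C ⟨k, ⟨0, hp k⟩⟩ := fun h' => ih2 k h h'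
          have hx' : x.val = m := hx
          have e : x = ⟨m, hx' ▸ x.isLt⟩ := Fin.ext hx'
          rw [e]
          exact this _
      · exact hk.symm
      · exfalso
        obtain ⟨y, hy, ha⟩ := s5G_fwd hq hs h ⟨m, hm⟩ hpos
        apply C.valid ha
        rw [← hk]
        exact (ih y.val hy k y.isLt).symm

theorem statement5 (q : ℕ) (hq : 3 ≤ q) (hqo : Odd q) (s : Fin q → ℕ)
    (hs : ∀ i, q + 2 ≤ s i ∧ s i ≤ 2 * q + 2) :
    ∃ G : SimpleGraph ((l : Fin q) × Fin (s l)),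
      (∃ M : Fin 4 → Set (Sym2 ((l : Fin q) × Fin (s l))),
        Pairwise (fun k l => Disjoint (M k) (M l)) ∧
        (⋃ k, M k) = G.edgeSet ∧
        ∀ i j : Fin q, i < j → ∀ k : Fin 4,
          IsMatchingSet (EdgesIn (M k) i j) ∧ (EdgesIn (M k) i j).ncard = q + 1) ∧
      G.chromaticNumber = (q : ℕ∞) ∧
      (∀ C : G.Coloring (Fin q), ∀ u v, C u = C v ↔ u.1 = v.1) := by
  have hp : ∀ i, 0 < s i := fun i => by have := hs i; omega
  refine ⟨s5G s, ⟨s5M s, s5_disj hq hqo hs, s5G_edgeSet s, fun i j hij k =>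
    ⟨s5_match hq hqo hs hij k, s5_card hq hqo hs hij k⟩⟩, ?_, ?_⟩
  · apply le_antisymm
    · apply SimpleGraph.Colorable.chromaticNumber_le
      exact ⟨SimpleGraph.Coloring.mk (fun v => v.1) (fun h => s5G_adj_fst h)⟩
    · rw [SimpleGraph.le_chromaticNumber_iff_coloring]
      intro m C
      have hinj : Function.Injective (fun i => C ⟨i, ⟨0, hp i⟩⟩) := by
        intro i j h
        by_contra hne
        exact C.valid (s5_clique hq hs hp hne) h
      simpa using Fintype.card_le_of_injective _ hinj
  · intro C u v
    obtain ⟨hinj, hf⟩ := s5_force hq hs hp C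
    obtain ⟨i, a, ha⟩ := u
    obtain ⟨j, b, hb⟩ := v
    rw [hf a i ha, hf b j hb]
    exact ⟨fun h => hinj h, fun h => by dsimp only at h; subst h; rfl⟩


end
end

section
/- For every integer q ≥ 2 there exists a family, indexed by the tuples (s₁,…,s_q) of integers with q+2 ≤ s_i ≤ 2q+2, of rooted quantum graphs P_{s₁,…,s_q} — that is, for each such tuple a finite list of (s₁+⋯+s_q)-rooted graphs H₁,…,H_m together with real coefficients c₁,…,c_m, where in each H_t the roots are partitioned into q groups of sizes s₁,…,s_q, the roots form an independent set, and H_t has exactly 2q(q−1) non-root vertices — with the following property: for every q-step kernel U with parts A₁,…,A_q there exists a real d₀ > 0, depending only on U and not on the tuple (s₁,…,s_q), such that for every tuple (s₁,…,s_q) and almost every choice of roots x ∈ [0,1]^{s₁+⋯+s_q}, the value ∑_{t=1}^m c_t · t_x(H_t,U) is either 0 or d₀, and it is nonzero if and only if there is a permutation π of [q] such that for each i∈[q] all roots of the i-th group lie in A_{π(i)} (so all roots of a group lie in a common part and roots of distinct groups lie in distinct parts). -/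
open MeasureTheory
open scoped BigOperators Classical

noncomputable section

theorem expand_aux {R : Type} [Fintype R] {b E : ℕ} (l r : Fin b → Fin E → R)
    (hl : ∀ y, Function.Injective (l y)) (hr : ∀ y, Function.Injective (r y))
    (hlr : ∀ y k k', l y k ≠ r y k') :
    ∃ (m : ℕ) (H : Fin m → SimpleGraph (R ⊕ Fin b)) (c : Fin m → ℝ),
      (∀ t, ∀ u v : R, ¬ (H t).Adj (Sum.inl u) (Sum.inl v)) ∧
      ∀ (U : GKernel) (x : R → I01),
        ∑ t, c t * rootedDensity (H t) U x =
          ∏ y : Fin b, ∫ z : I01, ∏ k, (U.toFun (x (l y k)) z - U.toFun (x (r y k)) z) := by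
  let T := (p : Fin b × Fin E) → Bool
  let rt : T → Fin b × Fin E → R := fun ε p => if ε p then l p.1 p.2 else r p.1 p.2
  let ed : T → Fin b × Fin E → Sym2 (R ⊕ Fin b) := fun ε p => s(Sum.inl (rt ε p), Sum.inr p.1)
  let G : T → SimpleGraph (R ⊕ Fin b) := fun ε => SimpleGraph.fromEdgeSet (Set.range (ed ε))
  let sg : T → ℝ := fun ε => ∏ p, (if ε p then (1 : ℝ) else -1)
  have hinj : ∀ ε, Function.Injective (ed ε) := by
    rintro ε ⟨y, k⟩ ⟨y', k'⟩ h
    simp only [ed, Sym2.eq_iff, Sum.inl.injEq, Sum.inr.injEq, reduceCtorEq, and_self, or_false,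
      false_and] at h
    obtain ⟨h1, rfl⟩ := h
    simp only [rt] at h1
    have := hlr y
    split_ifs at h1 with h2 h3 h3
    · rw [hl y h1]
    · exact absurd h1 (this _ _)
    · exact absurd h1.symm (this _ _)
    · rw [hr y h1]
  have hedge : ∀ ε, (Set.toFinite (G ε).edgeSet).toFinset = Finset.univ.image (ed ε) := by
    intro ε
    ext e
    simp only [Set.Finite.mem_toFinset, G, SimpleGraph.edgeSet_fromEdgeSet, Finset.mem_image,
      Finset.mem_univ, true_and, Set.mem_sdiff, Set.mem_range]
    constructor
    · exact fun h => h.1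
    · rintro ⟨p, rfl⟩
      refine ⟨⟨p, rfl⟩, ?_⟩
      simp [ed]
  have hdens : ∀ ε (U : GKernel) (x : R → I01), rootedDensity (G ε) U x =
      ∫ y : Fin b → I01, ∏ p : Fin b × Fin E, U.toFun (x (rt ε p)) (y p.1) := by
    intro ε U x
    unfold rootedDensity
    congr 1
    ext y
    rw [hedge, Finset.prod_image (fun a _ b _ h => hinj ε h)]
    rfl
  have e : T ≃ Fin (Fintype.card T) := Fintype.equivFin T
  refine ⟨Fintype.card T, fun t => G (e.symm t), fun t => sg (e.symm t), ?_, ?_⟩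
  · intro t u v h
    simp only [G, SimpleGraph.fromEdgeSet_adj, Set.mem_range, ed] at h
    obtain ⟨⟨p, hp⟩, -⟩ := h
    simp at hp
  · intro U x
    rw [Equiv.sum_comp e.symm (fun ε => sg ε * rootedDensity (G ε) U x)]
    simp only [hdens]
    simp only [← integral_const_mul]
    rw [← integral_finsetSum]
    · rw [← integral_fintype_prod_eq_prod (𝕜 := ℝ)
        (f := fun y z => ∏ k, (U.toFun (x (l y k)) z - U.toFun (x (r y k)) z))]
      congr 1
      ext y
      rw [← Fintype.prod_prod_type'
        (f := fun i k => (U.toFun (x (l i k)) (y i) - U.toFun (x (r i k)) (y i)))]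
      have key : ∀ p : Fin b × Fin E,
          (U.toFun (x (l p.1 p.2)) (y p.1) - U.toFun (x (r p.1 p.2)) (y p.1)) =
          ∑ β : Bool, (if β then (1 : ℝ) else -1) *
            U.toFun (x (if β then l p.1 p.2 else r p.1 p.2)) (y p.1) := by
        intro p
        simp
        ring
      rw [Finset.prod_congr rfl (fun p _ => key p), Fintype.prod_sum]
      refine Finset.sum_congr rfl fun ε _ => ?_
      rw [Finset.prod_mul_distrib]
    · intro ε _
      refine Integrable.const_mul ?_ _
      obtain ⟨C, hC⟩ := U.bounded'
      refine Integrable.of_bound (C := ∏ p : Fin b × Fin E, C) ?_ ?_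
      · refine Measurable.aestronglyMeasurable ?_
        refine Finset.measurable_prod _ fun p _ => ?_
        exact U.measurable'.comp ((measurable_const (a := x (rt ε p))).prodMk (measurable_pi_apply p.1))
      · refine Filter.Eventually.of_forall fun y => ?_
        rw [Real.norm_eq_abs, Finset.abs_prod]
        exact Finset.prod_le_prod (fun _ _ => abs_nonneg _) (fun _ _ => hC _ _)

abbrev OPair (q : ℕ) : Type := {p : Fin q × Fin q // p.1 ≠ p.2}

theorem card_aux (q : ℕ) : Fintype.card (OPair q × Bool) = 2 * q * (q - 1) := by
  have h : Fintype.card (OPair q) = q * q - q := by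
    rw [Fintype.card_subtype_compl]
    have : Fintype.card {p : Fin q × Fin q // p.1 = p.2} = q := by
      rw [Fintype.card_congr (β := Fin q)]
      · simp
      · exact ⟨fun p => p.1.1, fun i => ⟨(i, i), rfl⟩, by rintro ⟨⟨a, b⟩, h⟩; simp at h; simp [h],
          fun i => rfl⟩
    rw [this]; simp
  rw [Fintype.card_prod, h, Fintype.card_bool, ← Nat.mul_sub_one, mul_comm _ 2, mul_assoc]

theorem matching_aux_s6 (q E : ℕ) (hE : 0 < E) (s : Fin q → ℕ) (hs : ∀ i, E ≤ s i ∧ s i ≤ 2 * E) :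
    ∃ l r : OPair q × Bool → Fin E → (i : Fin q) × Fin (s i),
      (∀ y, Function.Injective (l y)) ∧ (∀ y, Function.Injective (r y)) ∧
      (∀ y k, (l y k).1 = y.1.1.1) ∧ (∀ y k, (r y k).1 = y.1.1.2) ∧
      ∀ χ : (i : Fin q) × Fin (s i) → Fin q, (∀ y k, χ (l y k) ≠ χ (r y k)) →
        ∃ π : Equiv.Perm (Fin q), ∀ v, χ v = π v.1 := by
  let L : OPair q × Bool → Fin E → (i : Fin q) × Fin (s i) := fun y k =>
    ⟨y.1.1.1, if h : y.2 = true ∧ k.1 + E < s y.1.1.1 then ⟨k.1 + E, h.2⟩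
      else ⟨k.1, lt_of_lt_of_le k.2 (hs _).1⟩⟩
  let R : OPair q × Bool → Fin E → (i : Fin q) × Fin (s i) := fun y k =>
    ⟨y.1.1.2, if y.2 = true ∨ y.1.1.1 < y.1.1.2 then ⟨k.1, lt_of_lt_of_le k.2 (hs _).1⟩
      else ⟨(k.1 + 1) % E, lt_of_lt_of_le (Nat.mod_lt _ hE) (hs _).1⟩⟩
  refine ⟨L, R, ?_, ?_, fun _ _ => rfl, fun _ _ => rfl, ?_⟩
  · intro y k k' h
    simp only [L, Sigma.mk.injEq, heq_eq_eq, true_and] at h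
    ext
    have := k.2
    have := k'.2
    split_ifs at h <;> simp only [Fin.mk.injEq] at h <;> omega
  · intro y k k' h
    simp only [R, Sigma.mk.injEq, heq_eq_eq, true_and] at h
    ext
    split_ifs at h <;> simp only [Fin.mk.injEq] at h
    · exact h
    · have h1 := Nat.ModEq.add_right_cancel' 1 (show k.1 + 1 ≡ k'.1 + 1 [MOD E] from h)
      exact Nat.ModEq.eq_of_lt_of_lt h1 k.2 k'.2
  · intro χ hχ
    let V : (i : Fin q) → (n : ℕ) → n < E → (i : Fin q) × Fin (s i) :=
      fun i n h => ⟨i, ⟨n, lt_of_lt_of_le h (hs i).1⟩⟩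
    have e1 : ∀ i j : Fin q, i < j → ∀ n h, χ (V i n h) ≠ χ (V j n h) := by
      intro i j hij n h
      have := hχ (⟨(i, j), hij.ne⟩, false) ⟨n, h⟩
      simpa [L, R, V, hij] using this
    have e2 : ∀ i j : Fin q, i < j → ∀ n (h : n + 1 < E),
        χ (V j n (by omega)) ≠ χ (V i (n + 1) h) := by
      intro i j hij n h
      have := hχ (⟨(j, i), hij.ne'⟩, false) ⟨n, by omega⟩
      simpa [L, R, V, hij.not_gt, Nat.mod_eq_of_lt h] using this
    have e3 : ∀ i j : Fin q, i ≠ j → ∀ n (h : n < E) (h' : n + E < s i),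
        χ ⟨i, ⟨n + E, h'⟩⟩ ≠ χ (V j n h) := by
      intro i j hij n h h'
      have := hχ (⟨(i, j), hij⟩, true) ⟨n, h⟩
      simpa [L, R, V, h'] using this
    let f : Fin q → Fin q := fun i => χ (V i 0 hE)
    have hf : Function.Injective f := by
      intro i j hij
      rcases lt_trichotomy i j with h | h | h
      · exact absurd hij (e1 i j h 0 hE)
      · exact h
      · exact absurd hij.symm (e1 j i h 0 hE)
    have hfb : Function.Bijective f := Finite.injective_iff_bijective.mp hf
    have fin : ∀ i c, (∀ j, j ≠ i → c ≠ f j) → c = f i := by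
      intro i c h
      obtain ⟨j, rfl⟩ := hfb.2 c
      by_contra hne
      exact h j (fun hji => hne (by rw [hji])) rfl
    have base : ∀ n (h : n < E) i, χ (V i n h) = f i := by
      intro n
      induction n with
      | zero => intro h i; rfl
      | succ n ih =>
        intro h i
        induction i using WellFoundedLT.induction with
        | ind i ihi =>
          apply fin
          intro j hj
          rcases lt_or_gt_of_ne hj with hji | hji
          · rw [← ihi j hji]
            exact (e1 j i hji _ h).symm
          · rw [← ih (by omega) j]
            exact (e2 i j hji n h).symm
    refine ⟨Equiv.ofBijective f hfb, ?_⟩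
    rintro ⟨i, n, hn⟩
    show _ = f i
    by_cases h : n < E
    · exact base n h i
    · have h2 := (hs i).2
      obtain ⟨k, rfl⟩ : ∃ k, n = k + E := ⟨n - E, by omega⟩
      have hk : k < E := by omega
      apply fin
      intro j hj
      rw [← base k hk j]
      exact e3 i j hj.symm k hk hn

theorem step_aux {U : GKernel} {q : ℕ} {A : Fin q → Set I01} (hA : IsStepPartition U A) :
    ∃ (c : I01 → Fin q) (p : Fin q → I01), (∀ x i, x ∈ A i ↔ c x = i) ∧ (∀ i, c (p i) = i) ∧
      ∀ x y, U.toFun x y = U.toFun (p (c x)) (p (c y)) := by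
  obtain ⟨-, hpos, hdis, hun, hc⟩ := hA
  have hex : ∀ x, ∃ i, x ∈ A i := fun x => by
    have : x ∈ ⋃ i, A i := by rw [hun]; trivial
    simpa using this
  choose c hc' using hex
  have hne : ∀ i, ∃ x, x ∈ A i := fun i => nonempty_of_measure_ne_zero (hpos i).ne'
  choose p hp using hne
  have hiff : ∀ x i, x ∈ A i ↔ c x = i := by
    intro x i
    constructor
    · intro h
      by_contra hne
      exact Set.disjoint_left.mp (hdis hne) (hc' x) h
    · rintro rfl; exact hc' x
  refine ⟨c, p, hiff, fun i => (hiff _ _).1 (hp i), ?_⟩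
  intro x y
  obtain ⟨d, hd⟩ := hc (c x) (c y)
  rw [hd x (hc' x) y (hc' y), hd _ (hp _) _ (hp _)]

theorem merge_aux {U : GKernel} {q : ℕ} {A : Fin q → Set I01} (hA : IsStepPartition U A)
    (hU : ¬ HasStepPartition U (q - 1)) (c : I01 → Fin q) (p : Fin q → I01)
    (hc : ∀ x i, x ∈ A i ↔ c x = i) (hp : ∀ i, c (p i) = i)
    (hUc : ∀ x y, U.toFun x y = U.toFun (p (c x)) (p (c y))) (i j : Fin q) (hij : i ≠ j) :
    ∃ k, U.toFun (p i) (p k) ≠ U.toFun (p j) (p k) := by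
  by_contra! hcon
  apply hU
  obtain ⟨n, rfl⟩ : ∃ n, q = n + 1 := ⟨q - 1, by have := i.2; omega⟩
  let φ : Fin (n + 1) → Fin (n + 1) := fun a => if a = j then i else a
  have hφ : ∀ a b, U.toFun (p (φ a)) (p b) = U.toFun (p a) (p b) := by
    intro a b
    simp only [φ]
    split_ifs with h
    · rw [h, hcon]
    · rfl
  have hφ2 : ∀ a b, U.toFun (p (φ a)) (p (φ b)) = U.toFun (p a) (p b) := by
    intro a b
    rw [hφ, U.symm', hφ, U.symm']
  have hA' : ∀ a, A a = c ⁻¹' {a} := by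
    intro a; ext x; simp [hc]
  have hmc : Measurable c := by
    apply measurable_to_countable'
    intro a; rw [← hA']; exact hA.1 a
  refine ⟨fun k => {x | φ (c x) = j.succAbove k}, ?_, ?_, ?_, ?_, ?_⟩
  · intro k
    exact hmc (MeasurableSet.of_discrete (s := {a | φ a = j.succAbove k}))
  · intro k
    refine lt_of_lt_of_le (hA.2.1 (j.succAbove k)) (measure_mono ?_)
    intro x hx
    rw [hc] at hx
    simp [φ, hx]
  · intro k k' hk
    rw [Set.disjoint_left]
    intro x hx hx'
    simp only [Set.mem_ofPred_eq] at hx hx'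
    exact hk (Fin.succAbove_right_injective (hx.symm.trans hx'))
  · ext x
    simp only [Set.mem_iUnion, Set.mem_ofPred_eq, Set.mem_univ, iff_true]
    have : φ (c x) ≠ j := by
      simp only [φ]; split_ifs with h
      · exact hij
      · exact h
    obtain ⟨k, hk⟩ := Fin.exists_succAbove_eq this
    exact ⟨k, hk.symm⟩
  · intro k k'
    refine ⟨U.toFun (p (j.succAbove k)) (p (j.succAbove k')), ?_⟩
    intro x hx y hy
    simp only [Set.mem_ofPred_eq] at hx hy
    rw [hUc, ← hφ2, hx, hy]

theorem pos_aux {U : GKernel} {q : ℕ} {A : Fin q → Set I01} (hA : IsStepPartition U A)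
    (c : I01 → Fin q) (p : Fin q → I01)
    (hc : ∀ x i, x ∈ A i ↔ c x = i) (hp : ∀ i, c (p i) = i)
    (hUc : ∀ x y, U.toFun x y = U.toFun (p (c x)) (p (c y))) (i j k : Fin q)
    (hk : U.toFun (p i) (p k) ≠ U.toFun (p j) (p k)) (E : ℕ) (hE : Even E) :
    0 < ∫ z : I01, (U.toFun (p i) z - U.toFun (p j) z) ^ E := by
  have hint : Integrable (fun z : I01 => (U.toFun (p i) z - U.toFun (p j) z) ^ E) := by
    obtain ⟨C, hC⟩ := U.bounded'
    refine Integrable.of_bound (C := (C + C) ^ E) ?_ ?_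
    · refine Measurable.aestronglyMeasurable ?_
      exact ((U.measurable'.comp (measurable_const.prodMk measurable_id)).sub
        (U.measurable'.comp (measurable_const.prodMk measurable_id))).pow_const E
    · refine Filter.Eventually.of_forall fun y => ?_
      rw [Real.norm_eq_abs, abs_pow]
      refine pow_le_pow_left₀ (abs_nonneg _) ?_ _
      exact (abs_sub _ _).trans (add_le_add (hC _ _) (hC _ _))
  rw [integral_pos_iff_support_of_nonneg (fun z => hE.pow_nonneg _) hint]
  refine lt_of_lt_of_le (hA.2.1 k) (measure_mono ?_)
  intro z hz
  rw [hc] at hz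
  rw [Function.mem_support]
  apply pow_ne_zero
  rw [sub_ne_zero, hUc, hUc (p j), hp, hp, hz]
  exact hk

theorem statement6 (q : ℕ) (hq : 2 ≤ q) :
    ∃ (m : (Fin q → ℕ) → ℕ)
      (H : (s : Fin q → ℕ) → Fin (m s) →
        SimpleGraph (((i : Fin q) × Fin (s i)) ⊕ Fin (2 * q * (q - 1))))
      (c : (s : Fin q → ℕ) → Fin (m s) → ℝ),
      (∀ s : Fin q → ℕ, ∀ t, ∀ u v : (i : Fin q) × Fin (s i),
        ¬ (H s t).Adj (Sum.inl u) (Sum.inl v)) ∧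
      ∀ (U : GKernel) (A : Fin q → Set I01),
        IsStepPartition U A → ¬ HasStepPartition U (q - 1) →
        ∃ d₀ : ℝ, 0 < d₀ ∧
          ∀ s : Fin q → ℕ, (∀ i, q + 2 ≤ s i ∧ s i ≤ 2 * q + 2) →
            ∀ᵐ x ∂(volume : Measure (((i : Fin q) × Fin (s i)) → I01)),
              (∑ t, c s t * rootedDensity (H s t) U x = 0 ∨
                ∑ t, c s t * rootedDensity (H s t) U x = d₀) ∧
              ((∑ t, c s t * rootedDensity (H s t) U x) ≠ 0 ↔
                ∃ π : Equiv.Perm (Fin q),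
                  ∀ v : (i : Fin q) × Fin (s i), x v ∈ A (π v.1)) := by
  obtain ⟨E, hEe, hE0, hE1, hE2⟩ : ∃ E, Even E ∧ 0 < E ∧ E ≤ q + 2 ∧ q + 1 ≤ E := by
    rcases Nat.even_or_odd q with h | h
    · exact ⟨q + 2, h.add even_two, by omega, le_rfl, by omega⟩
    · exact ⟨q + 1, h.add_one, by omega, by omega, le_rfl⟩
  let W : GKernel → (Fin q → I01) → ℝ := fun U p =>
    ∏ y : OPair q × Bool, ∫ z : I01, (U.toFun (p y.1.1.1) z - U.toFun (p y.1.1.2) z) ^ E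
  have main : ∀ s : Fin q → ℕ, ∃ (m : ℕ)
      (H : Fin m → SimpleGraph (((i : Fin q) × Fin (s i)) ⊕ Fin (2 * q * (q - 1))))
      (c : Fin m → ℝ),
      (∀ t, ∀ u v : (i : Fin q) × Fin (s i), ¬ (H t).Adj (Sum.inl u) (Sum.inl v)) ∧
      ((∀ i, q + 2 ≤ s i ∧ s i ≤ 2 * q + 2) →
        ∀ (U : GKernel) (d : I01 → Fin q) (p : Fin q → I01), (∀ i, d (p i) = i) →
        (∀ x y, U.toFun x y = U.toFun (p (d x)) (p (d y))) →
        ∀ x : ((i : Fin q) × Fin (s i)) → I01,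
          ((∃ π : Equiv.Perm (Fin q), ∀ v, d (x v) = π v.1) →
            ∑ t, c t * rootedDensity (H t) U x = W U p) ∧
          ((¬ ∃ π : Equiv.Perm (Fin q), ∀ v, d (x v) = π v.1) →
            ∑ t, c t * rootedDensity (H t) U x = 0)) := by
    intro s
    by_cases hs : ∀ i, q + 2 ≤ s i ∧ s i ≤ 2 * q + 2
    swap
    · exact ⟨0, fun t => t.elim0, fun t => t.elim0, fun t => t.elim0, fun h => absurd h hs⟩
    obtain ⟨l, r, hl, hr, hl1, hr1, huniq⟩ := matching_aux_s6 q E hE0 s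
      (fun i => by have := hs i; omega)
    let e : Fin (2 * q * (q - 1)) ≃ OPair q × Bool := (Fintype.equivFinOfCardEq (card_aux q)).symm
    obtain ⟨m, H, c, h1, h2⟩ := expand_aux (fun y => l (e y)) (fun y => r (e y))
      (fun y => hl _) (fun y => hr _) (by
        intro y k k' h
        have h3 := congrArg Sigma.fst h
        rw [hl1, hr1] at h3
        exact (e y).1.2 h3)
    refine ⟨m, H, c, h1, fun _ U d p hp hUd x => ?_⟩
    rw [h2, Equiv.prod_comp e (fun y => ∫ z : I01, ∏ k,
      (U.toFun (x (l y k)) z - U.toFun (x (r y k)) z))]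
    have hrow : ∀ v z, U.toFun v z = U.toFun (p (d v)) z := by
      intro v z
      rw [hUd v z, hUd (p (d v)) z, hp]
    constructor
    · rintro ⟨π, hπ⟩
      let eπ : OPair q × Bool ≃ OPair q × Bool :=
        (Equiv.subtypeEquiv (Equiv.prodCongr π π) (by simp)).prodCongr (Equiv.refl Bool)
      show _ = ∏ y : OPair q × Bool,
        ∫ z : I01, (U.toFun (p y.1.1.1) z - U.toFun (p y.1.1.2) z) ^ E
      rw [← Equiv.prod_comp eπ (fun y : OPair q × Bool =>
        ∫ z : I01, (U.toFun (p y.1.1.1) z - U.toFun (p y.1.1.2) z) ^ E)]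
      refine Finset.prod_congr rfl fun y _ => ?_
      congr 1
      ext z
      have : ∀ k, U.toFun (x (l y k)) z - U.toFun (x (r y k)) z =
          U.toFun (p (π y.1.1.1)) z - U.toFun (p (π y.1.1.2)) z := by
        intro k
        rw [hrow (x (l y k)), hrow (x (r y k)), hπ, hπ, hl1, hr1]
      rw [Finset.prod_congr rfl (fun k _ => this k)]
      simp [eπ]
    · intro hno
      have : ∃ y k, d (x (l y k)) = d (x (r y k)) := by
        by_contra! hcon
        exact hno (huniq (fun v => d (x v)) hcon)
      obtain ⟨y, k, hyk⟩ := this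
      apply Finset.prod_eq_zero (Finset.mem_univ y)
      have : ∀ z, ∏ k, (U.toFun (x (l y k)) z - U.toFun (x (r y k)) z) = 0 := by
        intro z
        apply Finset.prod_eq_zero (Finset.mem_univ k)
        rw [hrow (x (l y k)), hrow (x (r y k)), hyk, sub_self]
      simp [this]
  choose m H c hind hval using main
  refine ⟨m, H, c, hind, ?_⟩
  intro U A hA hU
  obtain ⟨d, p, hd, hp, hUd⟩ := step_aux hA
  have hW : 0 < W U p := by
    refine Finset.prod_pos fun y _ => ?_
    obtain ⟨k, hk⟩ := merge_aux hA hU d p hd hp hUd _ _ y.1.2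
    exact pos_aux hA d p hd hp hUd _ _ k hk E hEe
  refine ⟨W U p, hW, fun s hs => Filter.Eventually.of_forall fun x => ?_⟩
  obtain ⟨v1, v2⟩ := hval s hs U d p hp hUd x
  simp only [hd]
  by_cases h : ∃ π : Equiv.Perm (Fin q), ∀ v : (i : Fin q) × Fin (s i), d (x v) = π v.1
  · rw [v1 h]
    exact ⟨Or.inr rfl, fun _ => h, fun _ => hW.ne'⟩
  · rw [v2 h]
    exact ⟨Or.inl rfl, fun h0 => absurd rfl h0, fun h0 => absurd h0 h⟩

end
end

section
/- For all integers q ≥ 2 and k with 1 ≤ k ≤ q, and all reals d₁,…,d_k, there exist finitely many finite simple graphs H₁,…,H_m, each with exactly 3q² vertices, and real coefficients c₁,…,c_m, such that for every q-step kernel U: ∑_{t=1}^m c_t · t(H_t,U) = 0 if and only if the density of each part of U is one of the reals d₁,…,d_k. -/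
open MeasureTheory
open scoped BigOperators Classical

noncomputable section

/-! ### Multilinear polynomials in edge variables -/

def monE {n : ℕ} (T : Finset (Sym2 (Fin n))) : (Sym2 (Fin n) → ℝ) → ℝ := fun y => ∏ e ∈ T, y e

def SpE {n : ℕ} (S : Set (Sym2 (Fin n))) : Submodule ℝ ((Sym2 (Fin n) → ℝ) → ℝ) :=
  Submodule.span ℝ (monE '' {T | (T : Set (Sym2 (Fin n))) ⊆ S})

lemma SpE_mono {n : ℕ} {S S' : Set (Sym2 (Fin n))} (h : S ⊆ S') : SpE S ≤ SpE S' :=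
  Submodule.span_mono (Set.image_mono (fun _ hT => subset_trans hT h))

lemma SpE_one {n : ℕ} (S : Set (Sym2 (Fin n))) : (1 : (Sym2 (Fin n) → ℝ) → ℝ) ∈ SpE S := by
  apply Submodule.subset_span
  refine ⟨∅, by simp, ?_⟩
  funext y
  simp [monE]

lemma SpE_var {n : ℕ} {S : Set (Sym2 (Fin n))} {e : Sym2 (Fin n)} (h : e ∈ S) :
    (fun y : Sym2 (Fin n) → ℝ => y e) ∈ SpE S := by
  apply Submodule.subset_span
  refine ⟨{e}, by simpa using h, ?_⟩
  funext y
  simp [monE]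

lemma SpE_mul {n : ℕ} {S S' : Set (Sym2 (Fin n))} (h : Disjoint S S')
    {F G : (Sym2 (Fin n) → ℝ) → ℝ} (hF : F ∈ SpE S) (hG : G ∈ SpE S') : F * G ∈ SpE (S ∪ S') := by
  have h1 : F * G ∈ SpE S * SpE S' := Submodule.mul_mem_mul hF hG
  rw [SpE, SpE, Submodule.span_mul_span] at h1
  refine Submodule.span_mono ?_ h1
  rintro _ ⟨_, ⟨T, hT, rfl⟩, _, ⟨T', hT', rfl⟩, rfl⟩
  refine ⟨T ∪ T', ?_, ?_⟩
  · simp only [Set.mem_setOf_eq, Finset.coe_union] at *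
    exact Set.union_subset_union hT hT'
  · funext y
    have : Disjoint T T' := by
      rw [← Finset.disjoint_coe]
      exact h.mono hT hT'
    simp [monE, Finset.prod_union this]

lemma SpE_prod {n : ℕ} {ι : Type} (s : Finset ι) (S : ι → Set (Sym2 (Fin n)))
    (hS : ∀ i j, i ≠ j → Disjoint (S i) (S j))
    (F : ι → (Sym2 (Fin n) → ℝ) → ℝ) (hF : ∀ i, F i ∈ SpE (S i)) :
    (∏ i ∈ s, F i) ∈ SpE (⋃ i ∈ s, S i) := by
  induction s using Finset.induction_on with
  | empty => simpa using SpE_one _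
  | insert a s ha ih =>
    rw [Finset.prod_insert ha, Finset.set_biUnion_insert]
    apply SpE_mul _ (hF a) ih
    rw [Set.disjoint_iUnion₂_right]
    intro j hj
    apply hS
    rintro rfl
    exact ha hj

lemma SpE_sub {n : ℕ} (e e' : Sym2 (Fin n)) :
    (fun y : Sym2 (Fin n) → ℝ => y e - y e') ∈ SpE {e, e'} :=
  Submodule.sub_mem _ (SpE_var (by simp)) (SpE_var (by simp))

lemma SpE_subc {n : ℕ} (e : Sym2 (Fin n)) (d : ℝ) :
    (fun y : Sym2 (Fin n) → ℝ => y e - d) ∈ SpE {e} := by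
  have h := Submodule.sub_mem _ (SpE_var (show e ∈ ({e} : Set _) by simp))
    (Submodule.smul_mem _ d (SpE_one {e}))
  convert h using 1
  funext y
  simp

lemma SpE_graphs {n : ℕ} (F : (Sym2 (Fin n) → ℝ) → ℝ)
    (hF : F ∈ SpE {e : Sym2 (Fin n) | ¬ e.IsDiag}) :
    ∃ (m : ℕ) (H : Fin m → SimpleGraph (Fin n)) (c : Fin m → ℝ),
      ∀ y, F y = ∑ t, c t * ∏ e ∈ (Set.toFinite (H t).edgeSet).toFinset, y e := by
  have h1 : F ∈ Submodule.span ℝ (Set.range (fun H : SimpleGraph (Fin n) =>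
      monE (Set.toFinite H.edgeSet).toFinset)) := by
    refine Submodule.span_mono ?_ hF
    rintro _ ⟨T, hT, rfl⟩
    refine ⟨SimpleGraph.fromEdgeSet (T : Set _), ?_⟩
    dsimp only
    congr 1
    ext e
    simp only [Set.Finite.mem_toFinset, SimpleGraph.edgeSet_fromEdgeSet]
    constructor
    · intro h; exact h.1
    · intro h; exact ⟨h, hT h⟩
  rw [Submodule.mem_span_range_iff_exists_fun] at h1
  obtain ⟨c, hc⟩ := h1
  let E := (Fintype.equivFin (SimpleGraph (Fin n))).symm
  refine ⟨_, fun t => E t, fun t => c (E t), fun y => ?_⟩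
  rw [← hc, Finset.sum_apply, ← E.sum_comp]
  rfl

/-! ### Evaluation at kernels -/

def edgeVal {n : ℕ} (U : GKernel) (x : Fin n → I01) : Sym2 (Fin n) → ℝ :=
  Sym2.lift ⟨fun u v => U.toFun (x u) (x v), fun _ _ => U.symm' _ _⟩

lemma integrable_mon {n : ℕ} (U : GKernel) (T : Finset (Sym2 (Fin n))) :
    Integrable (fun x : Fin n → I01 => ∏ e ∈ T, edgeVal U x e) := by
  obtain ⟨C, hC⟩ := U.bounded'
  refine Integrable.of_bound (C := ∏ e ∈ T, C) ?_ ?_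
  · apply Measurable.aestronglyMeasurable
    apply Finset.measurable_prod
    intro e _
    induction e with
    | _ u v =>
      have h : Measurable (fun x : Fin n → I01 => (x u, x v)) :=
        (measurable_pi_apply u).prodMk (measurable_pi_apply v)
      exact U.measurable'.comp h
  · refine Filter.Eventually.of_forall fun x => ?_
    rw [norm_prod]
    apply Finset.prod_le_prod
    · intros; positivity
    · intro e _
      induction e with
      | _ u v => exact hC _ _

/-- A nonnegative combination vanishes iff its integrand vanishes on all boxes. -/
lemma comb_zero_iff {n m q : ℕ} (H : Fin m → SimpleGraph (Fin n)) (c : Fin m → ℝ)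
    (U : GKernel) (A : Fin q → Set I01) (hA : IsStepPartition U A)
    (b : Fin q → Fin q → ℝ) (hb : ∀ i j, ∀ x ∈ A i, ∀ y ∈ A j, U.toFun x y = b i j)
    (hbs : ∀ i j, b i j = b j i)
    (F : (Sym2 (Fin n) → ℝ) → ℝ)
    (hF : ∀ y, F y = ∑ t, c t * ∏ e ∈ (Set.toFinite (H t).edgeSet).toFinset, y e)
    (hpos : ∀ f : Fin n → Fin q,
      0 ≤ F (Sym2.lift ⟨fun u v => b (f u) (f v), fun _ _ => hbs _ _⟩)) :
    (∑ t, c t * homDensity (H t) U) = 0 ↔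
      ∀ f : Fin n → Fin q, F (Sym2.lift ⟨fun u v => b (f u) (f v), fun _ _ => hbs _ _⟩) = 0 := by
  obtain ⟨hm, hvol, hdis, hun, -⟩ := hA
  have hint : Integrable (fun x : Fin n → I01 => F (edgeVal U x)) := by
    simp only [hF]
    apply integrable_finset_sum
    intro t _
    exact (integrable_mon U _).const_mul _
  have hsum : (∑ t, c t * homDensity (H t) U) = ∫ x : Fin n → I01, F (edgeVal U x) := by
    simp only [hF]
    rw [integral_finset_sum]
    · apply Finset.sum_congr rfl
      intro t _
      rw [integral_const_mul]
      rfl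
    · intro t _
      exact (integrable_mon U _).const_mul _
  have hval : ∀ (f : Fin n → Fin q) (x : Fin n → I01), (∀ v, x v ∈ A (f v)) →
      edgeVal U x = Sym2.lift ⟨fun u v => b (f u) (f v), fun _ _ => hbs _ _⟩ := by
    intro f x hx
    funext e
    induction e with
    | _ u v => exact hb _ _ _ (hx u) _ (hx v)
  have hex : ∀ x : I01, ∃ i, x ∈ A i := by
    intro x
    have : x ∈ ⋃ i, A i := by rw [hun]; trivial
    simpa using this
  choose π hπ using hex
  have hnn : ∀ x : Fin n → I01, 0 ≤ F (edgeVal U x) := by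
    intro x
    rw [hval (fun v => π (x v)) x (fun v => hπ _)]
    exact hpos _
  rw [hsum, integral_eq_zero_iff_of_nonneg hnn hint]
  constructor
  · intro h f
    by_contra hne
    have h2 : volume (Set.univ.pi fun v => A (f v)) = 0 := by
      refine measure_mono_null ?_ h
      intro x hx
      simp only [Set.mem_univ_pi] at hx
      show ¬ (F (edgeVal U x) = 0)
      rw [hval f x hx]
      exact hne
    rw [volume_pi_pi] at h2
    rw [Finset.prod_eq_zero_iff] at h2
    obtain ⟨v, -, hv⟩ := h2
    exact (hvol (f v)).ne' hv
  · intro h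
    refine Filter.Eventually.of_forall fun x => ?_
    show F (edgeVal U x) = 0
    rw [hval (fun v => π (x v)) x (fun v => hπ _)]
    exact h _

lemma twin_free {q : ℕ} (U : GKernel) (A : Fin q → Set I01) (hA : IsStepPartition U A)
    (hno : ¬ HasStepPartition U (q - 1))
    (b : Fin q → Fin q → ℝ) (hb : ∀ i j, ∀ x ∈ A i, ∀ y ∈ A j, U.toFun x y = b i j)
    (hbs : ∀ i j, b i j = b j i) (i j : Fin q) (hij : i ≠ j) : ∃ l, b i l ≠ b j l := by
  by_contra! hrow
  apply hno
  obtain ⟨hm, hvol, hdis, hun, -⟩ := hA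
  have hcard : Fintype.card {l : Fin q // l ≠ j} = q - 1 := by simp
  let E : Fin (q - 1) ≃ {l : Fin q // l ≠ j} := (Fintype.equivFinOfCardEq hcard).symm
  let ρ : Fin q → Fin q := fun l => if l = j then i else l
  have hρ : ∀ l, ρ l ≠ j := by
    intro l
    by_cases h : l = j <;> simp [ρ, h, hij]
  have hρ' : ∀ l, l ≠ j → ρ l = l := fun l h => by simp [ρ, h]
  have hbρ : ∀ m l, b m l = b (ρ m) l := by
    intro m l
    by_cases h : m = j
    · simp [ρ, h, hrow]
    · simp [ρ, h]
  refine ⟨fun t => ⋃ m ∈ {m | ρ m = (E t).1}, A m, ?_, ?_, ?_, ?_, ?_⟩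
  · intro t
    exact MeasurableSet.biUnion (Set.to_countable _) (fun m _ => hm m)
  · intro t
    refine lt_of_lt_of_le (hvol (E t).1) (measure_mono ?_)
    exact Set.subset_biUnion_of_mem (u := A) (hρ' _ (E t).2)
  · intro s t hst
    simp only [Set.disjoint_iUnion_left, Set.disjoint_iUnion_right]
    intro m hm' m' hm''
    apply hdis
    rintro rfl
    apply hst
    apply E.injective
    apply Subtype.ext
    exact hm'.symm.trans hm'' |> fun h => by first | exact h | exact h.symm
  · rw [Set.eq_univ_iff_forall]
    intro x
    have : x ∈ ⋃ i, A i := by rw [hun]; trivial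
    obtain ⟨m, hxm⟩ := Set.mem_iUnion.1 this
    refine Set.mem_iUnion.2 ⟨E.symm ⟨ρ m, hρ m⟩, ?_⟩
    refine Set.mem_biUnion (x := m) ?_ hxm
    simp
  · intro s t
    refine ⟨b (E s).1 (E t).1, ?_⟩
    intro x hx y hy
    simp only [Set.mem_iUnion, Set.mem_setOf_eq] at hx hy
    obtain ⟨m, hm', hx⟩ := hx
    obtain ⟨m', hm'', hy⟩ := hy
    rw [hb m m' x hx y hy, hbρ, hbs, hbρ, hbs, hm', hm'']

/-! ### The gadget polynomial -/

abbrev CoreV (q k : ℕ) : Type := (Fin q × Bool) ⊕ Fin k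
abbrev GadV (q k : ℕ) (z : Fin q) : Type :=
  ((i : Fin q) × {j : Fin q // j ≠ i}) ⊕ (Fin k × {j : Fin q // j ≠ z})

def gA {q k : ℕ} (z : Fin q) : GadV q k z → CoreV q k
  | Sum.inl ⟨i, _⟩ => Sum.inl (i, false)
  | Sum.inr (l, _) => Sum.inr l

def gB {q k : ℕ} (z : Fin q) : GadV q k z → CoreV q k
  | Sum.inl ⟨i, j⟩ => Sum.inl (j.1, if i < j.1 then false else true)
  | Sum.inr (_, j) => Sum.inl (j.1, false)

def gA2 {q k : ℕ} (z : Fin q) : GadV q k z → CoreV q k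
  | Sum.inl ⟨i, _⟩ => Sum.inl (i, true)
  | Sum.inr (_, _) => Sum.inl (z, false)

def gB2 {q k : ℕ} (z : Fin q) : GadV q k z → CoreV q k
  | Sum.inl ⟨i, j⟩ => Sum.inl (j.1, if i < j.1 then true else false)
  | Sum.inr (_, j) => Sum.inl (j.1, true)

def gI {q k : ℕ} (z : Fin q) : GadV q k z → Fin q
  | Sum.inl ⟨i, _⟩ => i
  | Sum.inr (_, _) => z

def gJ {q k : ℕ} (z : Fin q) : GadV q k z → Fin q
  | Sum.inl ⟨_, j⟩ => j.1
  | Sum.inr (_, j) => j.1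

def clV {q k : ℕ} (z : Fin q) : CoreV q k → Fin q
  | Sum.inl (i, _) => i
  | Sum.inr _ => z

lemma gIJ {q k : ℕ} (z : Fin q) (t : GadV q k z) : gI z t ≠ gJ z t := by
  rcases t with ⟨i, j, h⟩ | ⟨l, j, h⟩
  · exact h.symm
  · exact h.symm

lemma g_cl {q k : ℕ} (z : Fin q) (t : GadV q k z) :
    clV z (gA z t) = gI z t ∧ clV z (gA2 z t) = gI z t ∧
    clV z (gB z t) = gJ z t ∧ clV z (gB2 z t) = gJ z t := by
  rcases t with ⟨i, j, h⟩ | ⟨l, j, h⟩ <;> simp [clV, gA, gA2, gB, gB2, gI, gJ]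

lemma g_ne {q k : ℕ} (z : Fin q) (t : GadV q k z) : gA z t ≠ gA2 z t ∧ gB z t ≠ gB2 z t := by
  rcases t with ⟨i, j, h⟩ | ⟨l, j, h⟩
  · simp only [gA, gA2, gB, gB2]
    split_ifs <;> simp
  · simp [gA, gA2, gB, gB2]

lemma g_ne' {q k : ℕ} (z : Fin q) (t : GadV q k z) :
    gA z t ≠ gB2 z t ∧ gB z t ≠ gA2 z t := by
  have h := g_cl z t
  have h' := gIJ z t
  constructor
  · intro e
    apply h'
    rw [← h.1, e, h.2.2.2]
  · intro e
    apply h'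
    rw [← h.2.1, ← e, h.2.2.1]

lemma coloring {q k : ℕ} (z : Fin q) (f : CoreV q k → Fin q)
    (h : ∀ t : GadV q k z, f (gA z t) ≠ f (gB z t) ∧ f (gA2 z t) ≠ f (gB2 z t)) :
    ∃ τ : Fin q → Fin q, Function.Bijective τ ∧ ∀ c, f c = τ (clV z c) := by
  have h1 : ∀ i j, i < j → ∀ ε δ : Bool, f (Sum.inl (i, ε)) ≠ f (Sum.inl (j, δ)) := by
    intro i j hij
    have a1 := h (Sum.inl ⟨i, j, hij.ne'⟩)
    have a2 := h (Sum.inl ⟨j, i, hij.ne⟩)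
    simp only [gA, gB, gA2, gB2, hij, not_lt_of_gt hij, if_true, if_false] at a1 a2
    intro ε δ
    cases ε <;> cases δ
    · exact a1.1
    · exact a2.2.symm
    · exact a2.1.symm
    · exact a1.2
  have h2 : ∀ i j, i ≠ j → ∀ ε δ : Bool, f (Sum.inl (i, ε)) ≠ f (Sum.inl (j, δ)) := by
    intro i j hij ε δ
    rcases lt_or_gt_of_ne hij with h | h
    · exact h1 i j h ε δ
    · exact (h1 j i h δ ε).symm
  have hinj : Function.Injective (fun i => f (Sum.inl (i, false))) := by
    intro i j hij
    by_contra hne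
    exact h2 i j hne _ _ hij
  have hbij := Finite.injective_iff_bijective.1 hinj
  refine ⟨_, hbij, ?_⟩
  rintro (⟨i, ε⟩ | l)
  · obtain ⟨j, hj⟩ := hbij.2 (f (Sum.inl (i, ε)))
    have : j = i := by
      by_contra hne
      exact h2 j i hne _ _ hj
    subst this
    exact hj.symm
  · obtain ⟨j, hj⟩ := hbij.2 (f (Sum.inr l))
    have : j = z := by
      by_contra hne
      exact (h (Sum.inr (l, ⟨j, hne⟩))).1 hj.symm
    subst this
    exact hj.symm

def bigF {q k n : ℕ} (z : Fin q) (d : Fin k → ℝ) (ι : CoreV q k ⊕ GadV q k z ↪ Fin n) :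
    (Sym2 (Fin n) → ℝ) → ℝ :=
  (∏ t : GadV q k z,
    ((fun y => y s(ι (Sum.inl (gA z t)), ι (Sum.inr t)) - y s(ι (Sum.inl (gB z t)), ι (Sum.inr t))) *
     (fun y => y s(ι (Sum.inl (gA2 z t)), ι (Sum.inr t)) -
        y s(ι (Sum.inl (gB2 z t)), ι (Sum.inr t))))) *
  ∏ l : Fin k,
    ((fun y => y s(ι (Sum.inl (Sum.inl (z, false))), ι (Sum.inl (Sum.inr l))) - d l) *
     (fun y => y s(ι (Sum.inl (Sum.inl (z, true))), ι (Sum.inl (Sum.inr l))) - d l))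

lemma bigF_mem {q k n : ℕ} (z : Fin q) (d : Fin k → ℝ) (ι : CoreV q k ⊕ GadV q k z ↪ Fin n) :
    bigF z d ι ∈ SpE {e : Sym2 (Fin n) | ¬ e.IsDiag} := by
  have hA := SpE_prod (n := n) (Finset.univ : Finset (GadV q k z))
    (fun t => {s(ι (Sum.inl (gA z t)), ι (Sum.inr t)), s(ι (Sum.inl (gB z t)), ι (Sum.inr t))} ∪
      {s(ι (Sum.inl (gA2 z t)), ι (Sum.inr t)), s(ι (Sum.inl (gB2 z t)), ι (Sum.inr t))})
    (by
      intro t t' htt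
      rw [Set.disjoint_left]
      intro e he he'
      simp only [Set.mem_union, Set.mem_insert_iff, Set.mem_singleton_iff] at he he'
      rcases he with (rfl | rfl) | (rfl | rfl) <;> simp [htt] at he')
    _ (fun t => SpE_mul (by
      have h1 := g_ne z t
      have h2 := g_ne' z t
      rw [Set.disjoint_left]
      intro e he he'
      simp only [Set.mem_insert_iff, Set.mem_singleton_iff] at he he'
      rcases he with rfl | rfl <;> simp [h1, h2] at he') (SpE_sub _ _) (SpE_sub _ _))
  have hB := SpE_prod (n := n) (Finset.univ : Finset (Fin k))
    (fun l => {s(ι (Sum.inl (Sum.inl (z, false))), ι (Sum.inl (Sum.inr l)))} ∪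
      {s(ι (Sum.inl (Sum.inl (z, true))), ι (Sum.inl (Sum.inr l)))})
    (by
      intro t t' htt
      rw [Set.disjoint_left]
      intro e he he'
      simp only [Set.mem_union, Set.mem_singleton_iff] at he he'
      rcases he with rfl | rfl <;> simp [htt] at he')
    _ (fun l => SpE_mul (by simp) (SpE_subc _ (d l)) (SpE_subc _ (d l)))
  refine SpE_mono ?_ (SpE_mul ?_ hA hB)
  · intro e he
    simp only [Set.mem_union, Set.mem_iUnion, Set.mem_insert_iff, Set.mem_singleton_iff] at he
    rcases he with ⟨t, -, (rfl | rfl) | (rfl | rfl)⟩ | ⟨l, -, rfl | rfl⟩ <;> simp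
  · rw [Set.disjoint_left]
    intro e he he'
    simp only [Set.mem_union, Set.mem_iUnion, Set.mem_insert_iff, Set.mem_singleton_iff] at he he'
    rcases he with ⟨t, -, (rfl | rfl) | (rfl | rfl)⟩ <;> simp at he'

lemma bigF_eval {q k n : ℕ} (z : Fin q) (d : Fin k → ℝ) (ι : CoreV q k ⊕ GadV q k z ↪ Fin n)
    (b : Fin q → Fin q → ℝ) (hbs : ∀ i j, b i j = b j i) (f : Fin n → Fin q) :
    bigF z d ι (Sym2.lift ⟨fun u v => b (f u) (f v), fun _ _ => hbs _ _⟩) =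
    (∏ t : GadV q k z,
      ((b (f (ι (Sum.inl (gA z t)))) (f (ι (Sum.inr t))) -
        b (f (ι (Sum.inl (gB z t)))) (f (ι (Sum.inr t)))) *
       (b (f (ι (Sum.inl (gA2 z t)))) (f (ι (Sum.inr t))) -
        b (f (ι (Sum.inl (gB2 z t)))) (f (ι (Sum.inr t)))))) *
    ∏ l : Fin k,
      ((b (f (ι (Sum.inl (Sum.inl (z, false))))) (f (ι (Sum.inl (Sum.inr l)))) - d l) *
       (b (f (ι (Sum.inl (Sum.inl (z, true))))) (f (ι (Sum.inl (Sum.inr l)))) - d l)) := by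
  simp [bigF, Finset.prod_apply]

lemma bigF_eval2 {q k n : ℕ} (z : Fin q) (d : Fin k → ℝ) (ι : CoreV q k ⊕ GadV q k z ↪ Fin n)
    (b : Fin q → Fin q → ℝ) (hbs : ∀ i j, b i j = b j i) (f : Fin n → Fin q)
    (τ : Fin q → Fin q) (hf : ∀ c, f (ι (Sum.inl c)) = τ (clV z c)) :
    bigF z d ι (Sym2.lift ⟨fun u v => b (f u) (f v), fun _ _ => hbs _ _⟩) =
    (∏ t : GadV q k z,
      (b (τ (gI z t)) (f (ι (Sum.inr t))) - b (τ (gJ z t)) (f (ι (Sum.inr t)))) ^ 2) *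
    ∏ l : Fin k, (b (τ z) (τ z) - d l) ^ 2 := by
  rw [bigF_eval]
  congr 1
  · apply Finset.prod_congr rfl
    intro t _
    obtain ⟨h1, h2, h3, h4⟩ := g_cl z t
    rw [hf, hf, hf, hf, h1, h2, h3, h4, sq]
  · apply Finset.prod_congr rfl
    intro l _
    rw [hf, hf, hf, sq]
    rfl

lemma bigF_cases {q k n : ℕ} (z : Fin q) (d : Fin k → ℝ) (ι : CoreV q k ⊕ GadV q k z ↪ Fin n)
    (b : Fin q → Fin q → ℝ) (hbs : ∀ i j, b i j = b j i) (f : Fin n → Fin q) :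
    bigF z d ι (Sym2.lift ⟨fun u v => b (f u) (f v), fun _ _ => hbs _ _⟩) = 0 ∨
    ∃ τ : Fin q → Fin q, ∀ c, f (ι (Sum.inl c)) = τ (clV z c) := by
  by_cases h : ∀ t : GadV q k z, f (ι (Sum.inl (gA z t))) ≠ f (ι (Sum.inl (gB z t))) ∧
      f (ι (Sum.inl (gA2 z t))) ≠ f (ι (Sum.inl (gB2 z t)))
  · obtain ⟨τ, -, hτ⟩ := coloring z (fun c => f (ι (Sum.inl c))) h
    exact Or.inr ⟨τ, hτ⟩
  · left
    push Not at h
    obtain ⟨t, ht⟩ := h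
    rw [bigF_eval]
    apply mul_eq_zero_of_left
    apply Finset.prod_eq_zero (Finset.mem_univ t)
    by_cases h1 : f (ι (Sum.inl (gA z t))) = f (ι (Sum.inl (gB z t)))
    · rw [h1]; simp
    · rw [ht h1]; simp

theorem statement7 (q k : ℕ) (hq : 2 ≤ q) (hk1 : 1 ≤ k) (hkq : k ≤ q)
    (d : Fin k → ℝ) :
    ∃ (m : ℕ) (H : Fin m → SimpleGraph (Fin (3 * q ^ 2))) (c : Fin m → ℝ),
      ∀ (U : GKernel) (A : Fin q → Set I01),
        IsStepPartition U A → ¬ HasStepPartition U (q - 1) →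
        ((∑ t, c t * homDensity (H t) U) = 0 ↔
          ∀ i : Fin q, ∃ l : Fin k, PartDensityIs U A i i (d l)) := by
  have hq0 : 0 < q := by omega
  let z : Fin q := ⟨0, hq0⟩
  have hcard : Fintype.card (CoreV q k ⊕ GadV q k z) ≤ Fintype.card (Fin (3 * q ^ 2)) := by
    simp only [Fintype.card_sum, Fintype.card_prod, Fintype.card_sigma, Fintype.card_fin,
      Fintype.card_bool, Fintype.card_subtype_compl, Fintype.card_unique, Finset.sum_const,
      Finset.card_univ, smul_eq_mul, ne_eq]
    obtain ⟨r, rfl⟩ : ∃ r, q = r + 1 := ⟨q - 1, by omega⟩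
    simp only [Nat.add_sub_cancel]
    nlinarith [Nat.mul_le_mul_right r hkq]
  obtain ⟨ι⟩ := Function.Embedding.nonempty_of_card_le hcard
  obtain ⟨m, H, c, hF⟩ := SpE_graphs _ (bigF_mem z d ι)
  refine ⟨m, H, c, ?_⟩
  intro U A hA hno
  choose b hb using hA.2.2.2.2
  have hne : ∀ i, (A i).Nonempty := fun i => nonempty_of_measure_ne_zero (hA.2.1 i).ne'
  have hbs : ∀ i j, b i j = b j i := by
    intro i j
    obtain ⟨x, hx⟩ := hne i
    obtain ⟨y, hy⟩ := hne j
    rw [← hb i j x hx y hy, U.symm', hb j i y hy x hx]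
  have htw := twin_free U A hA hno b hb hbs
  have hpd : ∀ i v, PartDensityIs U A i i v ↔ b i i = v := by
    intro i v
    constructor
    · intro h
      obtain ⟨x, hx⟩ := hne i
      rw [← hb i i x hx x hx, h x hx x hx]
    · rintro rfl x hx y hy
      exact hb i i x hx y hy
  simp only [hpd]
  rw [comb_zero_iff H c U A hA b hb hbs _ hF]
  · constructor
    · intro h i
      by_contra! hi
      let τ : Fin q → Fin q := Equiv.swap z i
      have hτ : ∀ t : GadV q k z, ∃ l, b (τ (gI z t)) l ≠ b (τ (gJ z t)) l := fun t =>
        htw _ _ (fun e => gIJ z t ((Equiv.swap z i).injective e))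
      choose g hg using hτ
      let f0 : CoreV q k ⊕ GadV q k z → Fin q := Sum.elim (fun c => τ (clV z c)) g
      let f : Fin (3 * q ^ 2) → Fin q := Function.extend ι f0 (fun _ => z)
      have hf : ∀ v, f (ι v) = f0 v := fun v => ι.injective.extend_apply _ _ _
      have h1 := h f
      rw [bigF_eval2 z d ι b hbs f τ (fun c => hf _)] at h1
      have hτz : τ z = i := Equiv.swap_apply_left z i
      rcases mul_eq_zero.1 h1 with h2 | h2
      · obtain ⟨t, -, ht⟩ := Finset.prod_eq_zero_iff.1 h2
        rw [hf] at ht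
        exact hg t (sub_eq_zero.1 (pow_eq_zero_iff (two_ne_zero)|>.1 ht))
      · obtain ⟨l, -, hl⟩ := Finset.prod_eq_zero_iff.1 h2
        rw [hτz] at hl
        exact hi l (sub_eq_zero.1 (pow_eq_zero_iff (two_ne_zero)|>.1 hl))
    · intro h f
      rcases bigF_cases z d ι b hbs f with h0 | ⟨τ, hτ⟩
      · exact h0
      · rw [bigF_eval2 z d ι b hbs f τ hτ]
        obtain ⟨l, hl⟩ := h (τ z)
        apply mul_eq_zero_of_right
        apply Finset.prod_eq_zero (Finset.mem_univ l)
        rw [hl]; simp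
  · intro f
    rcases bigF_cases z d ι b hbs f with h0 | ⟨τ, hτ⟩
    · exact h0.ge
    · rw [bigF_eval2 z d ι b hbs f τ hτ]
      apply mul_nonneg <;> exact Finset.prod_nonneg (fun _ _ => sq_nonneg _)

end
end
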